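/- Let d ≥ 2, α ∈ (1,2), and let μ be a nondegenerate α-stable distribution on ℝ^d with no shift and characteristic exponent Φ_μ(z) = |z|^α V(u_z). Let R > sup_{u ∈ S^{d−1}} |V(u)|²/(2 Re V(u)), set V* = R − V and S*_{j,k} = (−i)^j proj_j(V*^k). Then the density g of μ satisfies g(x) = (2^{1−d}/(π^{d/2} α)) Σ_{n=0}^∞ (|x|/2)^n Σ_{m=0}^{⌊n/2⌋} ((−1)^m/(m! Γ(n−m+d/2))) Σ_{k=0}^∞ (Γ(k+(n+d)/α)/(k! R^{k+(n+d)/α})) S*_{n−2m,k}(u_x), with the series converging absolutely, uniformly on {x : |x| ≤ M} for every M > 0; and if X ∼ μ, then |X| has density g_{|X|}(r) = ((r/2)^{d−1}/(π^{d/2} α)) Σ_{n=0}^∞ ((−r²/4)^n/(n! Γ(n+d/2))) Σ_{k=0}^∞ (Γ(k+(2n+d)/α)/(k! R^{k+(2n+d)/α})) ∫_{S^{d−1}} V*^k dω. -/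

import Mathlib

open MeasureTheory Real Filter Topology
open scoped RealInnerProductSpace ENNReal NNReal

noncomputable section

namespace StablePaper

abbrev Ed (d : ℕ) : Type := EuclideanSpace ℝ (Fin d)

abbrev Sph (d : ℕ) := Metric.sphere (0 : Ed d) 1

/-- The surface measure `ω` on the unit sphere `S^{d-1}`. -/
def ωd (d : ℕ) : Measure (Sph d) := (volume : Measure (Ed d)).toSphere

/-- `u_z = z/|z|` for `z ≠ 0`, as a point of the unit sphere. -/
def unitize {d : ℕ} (z : Ed d) (hz : z ≠ 0) : Sph d :=
  ⟨‖z‖⁻¹ • z, by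
    rw [mem_sphere_iff_norm, sub_zero, norm_smul, norm_inv, norm_norm,
      inv_mul_cancel₀ (norm_ne_zero_iff.mpr hz)]⟩

/-- Negation on the unit sphere. -/
def negS {d : ℕ} (u : Sph d) : Sph d :=
  ⟨-(u : Ed d), by
    rw [mem_sphere_iff_norm, sub_zero, norm_neg]
    have := u.2
    rwa [mem_sphere_iff_norm, sub_zero] at this⟩

/-- Rising factorial (Pochhammer symbol) `(b)_n`. -/
def risingFactorial (b : ℝ) (n : ℕ) : ℝ := ∏ i ∈ Finset.range n, (b + i)

/-- The Gegenbauer polynomial `C_j^b(t)` (for `b > 0`), via its explicit sum formula. -/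
def gegenbauer (b : ℝ) (j : ℕ) (t : ℝ) : ℝ :=
  ∑ m ∈ Finset.range (j / 2 + 1),
    (-1 : ℝ) ^ m * 2 ^ (j - 2 * m) * risingFactorial b (j - m) /
      ((Nat.factorial m : ℝ) * (Nat.factorial (j - 2 * m) : ℝ)) * t ^ (j - 2 * m)

/-- The normalized (ultraspherical) polynomial `C̃_j^b(t) = C_j^b(t)/C_j^b(1)`;
for `b = 0` it is the Chebyshev polynomial `T_j`. -/
def gegenbauerN (b : ℝ) (j : ℕ) (t : ℝ) : ℝ :=
  if b = 0 then (Polynomial.Chebyshev.T ℝ (j : ℤ)).eval t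
  else gegenbauer b j t / gegenbauer b j 1

/-- `c_{j,d} = dim ℋ_{j,d}`. -/
def cdim (d j : ℕ) : ℕ :=
  if j = 0 then 1 else Nat.choose (j + d - 2) j + Nat.choose (j + d - 3) (j - 1)

/-- The surface area `A(S^{d-1}) = 2 π^{d/2} / Γ(d/2)`. -/
def sphereArea (d : ℕ) : ℝ := 2 * Real.pi ^ ((d : ℝ) / 2) / Real.Gamma ((d : ℝ) / 2)

/-- Projection onto spherical harmonics of degree `j` (real-valued version):
`(proj_j f)(u) = (c_{j,d}/A(S^{d-1})) ∫ C̃_j^{(d-2)/2}(⟨u,v⟩) f(v) ω(dv)`. -/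
def projR (d j : ℕ) (f : Sph d → ℝ) (u : Sph d) : ℝ :=
  (cdim d j : ℝ) / sphereArea d *
    ∫ v, gegenbauerN (((d : ℝ) - 2) / 2) j ⟪(u : Ed d), (v : Ed d)⟫ * f v ∂(ωd d)

/-- Projection onto spherical harmonics of degree `j` (complex-valued version). -/
def projC (d j : ℕ) (f : Sph d → ℂ) (u : Sph d) : ℂ :=
  ((cdim d j : ℂ) / (sphereArea d : ℂ)) *
    ∫ v, (gegenbauerN (((d : ℝ) - 2) / 2) j ⟪(u : Ed d), (v : Ed d)⟫ : ℂ) * f v ∂(ωd d)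

/-- The coefficients `w_j(α)`. -/
def w (d : ℕ) (α : ℝ) (j : ℕ) : ℝ :=
  Real.pi ^ ((d : ℝ) / 2) * Real.Gamma (α + 1) /
    (2 ^ (α - 1) * Real.Gamma (((j : ℝ) + α + d) / 2) * Real.Gamma ((α - j) / 2 + 1))

/-- The characteristic exponent of an `α`-stable distribution (`α ≠ 1`) with
spectral spherical measure `Λ`. -/
def charExp (d : ℕ) (α : ℝ) (Λ : Measure (Sph d)) (z : Ed d) : ℂ :=
  ∫ v, (|⟪z, (v : Ed d)⟫| ^ α : ℝ) *
      (1 - Complex.I * (Real.tan (Real.pi * α / 2) : ℂ) *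
        (Real.sign ⟪z, (v : Ed d)⟫ : ℂ)) ∂Λ

/-- `V(u)`, so that `Φ_μ(z) = |z|^α V(u_z)`. -/
def Vfun (d : ℕ) (α : ℝ) (Λ : Measure (Sph d)) (u : Sph d) : ℂ :=
  charExp d α Λ (u : Ed d)

/-- The characteristic exponent of a `1`-stable distribution with
spectral spherical measure `Λ`. -/
def charExp1 (d : ℕ) (Λ : Measure (Sph d)) (z : Ed d) : ℂ :=
  ∫ v, ((|⟪z, (v : Ed d)⟫| : ℝ) : ℂ) +
      Complex.I * ((2 / Real.pi * (⟪z, (v : Ed d)⟫ *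
        Real.log |⟪z, (v : Ed d)⟫|) : ℝ) : ℂ) ∂Λ

/-- The spectral spherical measure `λ(dv) = P(v) ω(dv)`. -/
def specMeasure (d : ℕ) (P : Sph d → ℝ) : Measure (Sph d) :=
  (ωd d).withDensity (fun v => ENNReal.ofReal (P v))

/-- `μ` has Fourier transform `exp (-Φ)` where `Φ` is the `α`-stable characteristic
exponent with spectral spherical measure `Λ` (case `α ≠ 1`). -/
def IsStableChar (d : ℕ) (α : ℝ) (Λ : Measure (Sph d)) (μ : Measure (Ed d)) : Prop :=
  ∀ z : Ed d, ∫ x, Complex.exp (Complex.I * (⟪z, x⟫ : ℂ)) ∂μ =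
    Complex.exp (- charExp d α Λ z)

/-- `μ` has Fourier transform `exp (-Φ)` where `Φ` is the `1`-stable characteristic
exponent with spectral spherical measure `Λ`. -/
def IsStableChar1 (d : ℕ) (Λ : Measure (Sph d)) (μ : Measure (Ed d)) : Prop :=
  ∀ z : Ed d, ∫ x, Complex.exp (Complex.I * (⟪z, x⟫ : ℂ)) ∂μ =
    Complex.exp (- charExp1 d Λ z)

/-- `μ` is nondegenerate: its support is not contained in any proper affine subspace. -/
def Nondegenerate (d : ℕ) (μ : Measure (Ed d)) : Prop :=
  ∀ (a : Ed d) (W : Submodule ℝ (Ed d)), W ≠ ⊤ →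
    μ ((fun x => a + x) '' (W : Set (Ed d))) < 1

/-- `P` is the restriction to the sphere of a polynomial on `ℝ^d`. -/
def IsPolyRestriction (d : ℕ) (P : Sph d → ℝ) : Prop :=
  ∃ p : MvPolynomial (Fin d) ℝ,
    ∀ u : Sph d, P u = MvPolynomial.eval (fun i => (u : Ed d) i) p

/-- `P` is the restriction to the sphere of a polynomial of degree at most `q`. -/
def IsPolyRestrictionDeg (d q : ℕ) (P : Sph d → ℝ) : Prop :=
  ∃ p : MvPolynomial (Fin d) ℝ, p.totalDegree ≤ q ∧
    ∀ u : Sph d, P u = MvPolynomial.eval (fun i => (u : Ed d) i) p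

/-- `f` is a spherical harmonic of degree `j`: the restriction to the sphere of a
homogeneous harmonic polynomial of degree `j`. -/
def IsSphericalHarmonicC (d j : ℕ) (f : Sph d → ℂ) : Prop :=
  ∃ p : MvPolynomial (Fin d) ℂ, p.IsHomogeneous j ∧
    (∑ i : Fin d, MvPolynomial.pderiv i (MvPolynomial.pderiv i p)) = 0 ∧
    ∀ u : Sph d, f u = MvPolynomial.eval (fun i => ((u : Ed d) i : ℂ)) p

/-- `S_{j,k} = (-i)^j proj_j (V^k)`. -/
def SHk (d : ℕ) (α : ℝ) (Λ : Measure (Sph d)) (j k : ℕ) (u : Sph d) : ℂ :=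
  (-Complex.I) ^ j * projC d j (fun v => (Vfun d α Λ v) ^ k) u

/-- `S_{j,p} = (-i)^j proj_j (V^p)` for real exponents `p` (principal branch). -/
def SHp (d : ℕ) (α : ℝ) (Λ : Measure (Sph d)) (j : ℕ) (p : ℝ) (u : Sph d) : ℂ :=
  (-Complex.I) ^ j * projC d j (fun v => (Vfun d α Λ v) ^ (p : ℂ)) u

/-- `g` is the density of the stable distribution with characteristic exponent
`charExp d α Λ`, given by the Fourier inversion formula. -/
def IsDensityOf (d : ℕ) (α : ℝ) (Λ : Measure (Sph d)) (g : Ed d → ℝ) : Prop :=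
  ∀ x : Ed d, (g x : ℂ) =
    (((2 * Real.pi) ^ d)⁻¹ : ℝ) *
      ∫ z : Ed d, Complex.exp (-(Complex.I * (⟪x, z⟫ : ℂ))) *
        Complex.exp (- charExp d α Λ z)

/-- Harmonic numbers `s_n`. -/
def harmonicNum (n : ℕ) : ℝ := ∑ i ∈ Finset.range n, (1 : ℝ) / (i + 1)

def betaD (d : ℕ) : ℝ :=
  if Even d then 1 - Real.log 2 - harmonicNum (d / 2) / 2
  else 1 - harmonicNum (d + 1) + harmonicNum ((d + 1) / 2) / 2

/-- The coefficients `w*_j` (for odd `j`). -/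
def wstar (d j : ℕ) : ℝ :=
  if j = 1 then Real.pi ^ ((d : ℝ) / 2) * betaD d / Real.Gamma ((d : ℝ) / 2 + 1)
  else (-1 : ℝ) ^ ((j - 3) / 2) * Real.pi ^ ((d : ℝ) / 2) *
      Real.Gamma (((j : ℝ) - 1) / 2) / (2 * Real.Gamma (((d : ℝ) + 1 + j) / 2))

/-- The Bessel function of the first kind `J_τ`. -/
def besselJ (τ : ℝ) (x : ℝ) : ℝ :=
  ∑' k : ℕ, (-1 : ℝ) ^ k * (x / 2) ^ (2 * (k : ℝ) + τ) /
    ((Nat.factorial k : ℝ) * Real.Gamma ((k : ℝ) + τ + 1))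

/-- The `(j,k)`-term `((-2^α)^k π^{-d/2} / (k! ρ^{kα+d})) (Γ((j+kα+d)/2)/Γ((j-kα)/2)) S_{j,k}(u)`
of the spherical-harmonic series for the density (`α ∈ (0,1)`), at radius `ρ`. -/
def phiTerm (d : ℕ) (α : ℝ) (Λ : Measure (Sph d)) (j k : ℕ) (ρ : ℝ) (u : Sph d) : ℂ :=
  ((((-((2 : ℝ) ^ α)) ^ k * Real.pi ^ (-(d : ℝ) / 2) /
      ((Nat.factorial k : ℝ) * ρ ^ ((k : ℝ) * α + d)) *
      (Real.Gamma (((j : ℝ) + k * α + d) / 2) /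
        Real.Gamma (((j : ℝ) - k * α) / 2))) : ℝ) : ℂ) * SHk d α Λ j k u

/-- The `k`-th term `((-2^α)^k π^{-d/2} / (k! r^{kα+1})) (Γ((kα+d)/2)/Γ(-kα/2)) ∫ V^k dω`
of the series for the density of `|X|`. -/
def radTerm (d : ℕ) (α : ℝ) (Λ : Measure (Sph d)) (k : ℕ) (r : ℝ) : ℂ :=
  ((((-((2 : ℝ) ^ α)) ^ k * Real.pi ^ (-(d : ℝ) / 2) /
      ((Nat.factorial k : ℝ) * r ^ ((k : ℝ) * α + 1)) *
      (Real.Gamma (((k : ℝ) * α + d) / 2) / Real.Gamma (-((k : ℝ) * α) / 2))) : ℝ) : ℂ) *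
    ∫ u, (Vfun d α Λ u) ^ k ∂(ωd d)

end StablePaper

namespace StablePaper

/-- `S*_{j,k} = (-i)^j proj_j ((R-V)^k)`. -/
def SHstar (d : ℕ) (α : ℝ) (Λ : Measure (Sph d)) (R : ℝ) (j k : ℕ) (u : Sph d) : ℂ :=
  (-Complex.I) ^ j * projC d j (fun v => ((R : ℂ) - Vfun d α Λ v) ^ k) u

open scoped FourierTransform

lemma risingFactorial_succ (b : ℝ) (n : ℕ) :
    risingFactorial b (n + 1) = risingFactorial b n * (b + n) :=
  Finset.prod_range_succ _ _

/-- The `m`-th coefficient of the Gegenbauer polynomial, extended by zero. -/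
def gegCoeff (b : ℝ) (j m : ℕ) : ℝ :=
  if 2 * m ≤ j then (-1 : ℝ) ^ m * 2 ^ (j - 2 * m) * risingFactorial b (j - m) /
      ((Nat.factorial m : ℝ) * (Nat.factorial (j - 2 * m) : ℝ)) else 0

lemma sum_range_eq_of_eq_zero {N M : ℕ} (hNM : N ≤ M) (f : ℕ → ℝ) (hf : ∀ m, N ≤ m → f m = 0) :
    ∑ m ∈ Finset.range M, f m = ∑ m ∈ Finset.range N, f m :=
  (Finset.sum_subset (Finset.range_mono hNM) fun m _ hm => hf m (by simpa using hm)).symm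

lemma gegenbauer_eq_sum (b : ℝ) (j : ℕ) (t : ℝ) {N : ℕ} (hN : j / 2 + 1 ≤ N) :
    gegenbauer b j t = ∑ m ∈ Finset.range N, gegCoeff b j m * t ^ (j - 2 * m) := by
  rw [sum_range_eq_of_eq_zero hN]
  · refine Finset.sum_congr rfl fun m hm => ?_
    have : 2 * m ≤ j := by have := Finset.mem_range.1 hm; omega
    simp [gegCoeff, this]
  · intro m hm
    have : ¬ 2 * m ≤ j := by omega
    simp [gegCoeff, this]

lemma gegCoeff_zero_rec (b : ℝ) (j : ℕ) :
    ((j : ℝ) + 2) * gegCoeff b (j + 2) 0 = 2 * (j + 1 + b) * gegCoeff b (j + 1) 0 := by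
  have h1 : ((j + 1).factorial : ℝ) ≠ 0 := by positivity
  simp only [gegCoeff, mul_zero, zero_le, if_true, Nat.sub_zero, pow_zero, Nat.factorial_zero,
    Nat.cast_one, one_mul]
  rw [risingFactorial_succ b (j + 1), Nat.factorial_succ (j + 1)]
  push_cast
  field_simp
  ring

lemma gegCoeff_succ_rec (b : ℝ) (j m : ℕ) :
    ((j : ℝ) + 2) * gegCoeff b (j + 2) (m + 1) =
      2 * (j + 1 + b) * gegCoeff b (j + 1) (m + 1) - (j + 2 * b) * gegCoeff b j m := by
  by_cases h : 2 * m ≤ j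
  · obtain ⟨i, rfl⟩ := Nat.exists_eq_add_of_le h
    have hm : (m.factorial : ℝ) ≠ 0 := by positivity
    rcases i with _ | i
    · have e1 : 2 * m + 0 + 2 - 2 * (m + 1) = 0 := by omega
      have e2 : 2 * m + 0 + 2 - (m + 1) = m + 1 := by omega
      have e3 : 2 * m + 0 - m = m := by omega
      have e4 : ¬ 2 * (m + 1) ≤ 2 * m + 0 + 1 := by omega
      have e5 : 2 * (m + 1) ≤ 2 * m + 0 + 2 := by omega
      simp only [gegCoeff, e1, e2, e3, e4, e5, h, if_true, if_false]
      simp only [add_zero, Nat.sub_self, Nat.factorial_succ, risingFactorial_succ]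
      push_cast
      field_simp
      ring
    · have hi : (i.factorial : ℝ) ≠ 0 := by positivity
      have e1 : 2 * m + (i + 1) + 2 - 2 * (m + 1) = i + 1 := by omega
      have e2 : 2 * m + (i + 1) + 2 - (m + 1) = m + i + 2 := by omega
      have e3 : 2 * m + (i + 1) - m = m + i + 1 := by omega
      have e4 : 2 * (m + 1) ≤ 2 * m + (i + 1) + 1 := by omega
      have e5 : 2 * (m + 1) ≤ 2 * m + (i + 1) + 2 := by omega
      have e6 : 2 * m + (i + 1) + 1 - 2 * (m + 1) = i := by omega
      have e7 : 2 * m + (i + 1) + 1 - (m + 1) = m + i + 1 := by omega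
      have e8 : 2 * m + (i + 1) - 2 * m = i + 1 := by omega
      simp only [gegCoeff, e1, e2, e3, e4, e5, e6, e7, e8, h, if_true]
      rw [risingFactorial_succ b (m + i + 1)]
      simp only [Nat.factorial_succ]
      push_cast
      field_simp
      ring
  · have e1 : ¬ 2 * (m + 1) ≤ j + 2 := by omega
    have e2 : ¬ 2 * (m + 1) ≤ j + 1 := by omega
    simp [gegCoeff, h, e1, e2]

/-- Three-term recurrence for Gegenbauer polynomials. -/
lemma gegenbauer_rec (b : ℝ) (j : ℕ) (t : ℝ) :
    ((j : ℝ) + 2) * gegenbauer b (j + 2) t =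
      2 * (j + 1 + b) * (t * gegenbauer b (j + 1) t) - (j + 2 * b) * gegenbauer b j t := by
  rw [gegenbauer_eq_sum b (j + 2) t (N := j + 3) (by omega),
    gegenbauer_eq_sum b (j + 1) t (N := j + 3) (by omega),
    gegenbauer_eq_sum b j t (N := j + 2) (by omega)]
  have hshift : ∀ m, gegCoeff b (j + 1) m * (t * t ^ (j + 1 - 2 * m)) =
      gegCoeff b (j + 1) m * t ^ (j + 2 - 2 * m) := by
    intro m
    by_cases h : 2 * m ≤ j + 1
    · rw [← pow_succ', show j + 1 - 2 * m + 1 = j + 2 - 2 * m by omega]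
    · simp [gegCoeff, h]
  have h2 : t * ∑ m ∈ Finset.range (j + 3), gegCoeff b (j + 1) m * t ^ (j + 1 - 2 * m) =
      ∑ m ∈ Finset.range (j + 3), gegCoeff b (j + 1) m * t ^ (j + 2 - 2 * m) := by
    rw [Finset.mul_sum]
    exact Finset.sum_congr rfl fun m _ => by rw [← hshift m]; ring
  rw [h2, Finset.sum_range_succ', Finset.sum_range_succ' (n := j + 2), mul_add, mul_add,
    ← mul_assoc, gegCoeff_zero_rec, mul_assoc, Finset.mul_sum, Finset.mul_sum, Finset.mul_sum,
    add_sub_right_comm, ← Finset.sum_sub_distrib]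
  congr 1
  refine Finset.sum_congr rfl fun m _ => ?_
  rw [← mul_assoc, gegCoeff_succ_rec, show j + 2 - 2 * (m + 1) = j - 2 * m by omega]
  ring

lemma gegenbauer_zero (b t : ℝ) : gegenbauer b 0 t = 1 := by
  simp [gegenbauer, risingFactorial]

lemma gegenbauer_one (b t : ℝ) : gegenbauer b 1 t = 2 * b * t := by
  simp [gegenbauer, risingFactorial]

lemma gegenbauer_at_one (b : ℝ) (j : ℕ) :
    gegenbauer b j 1 = risingFactorial (2 * b) j / (j.factorial : ℝ) := by
  induction j using Nat.twoStepInduction with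
  | zero => simp [gegenbauer_zero, risingFactorial]
  | one => simp [gegenbauer_one, risingFactorial]
  | more j ih1 ih2 =>
    have h := gegenbauer_rec b j 1
    rw [ih1, ih2] at h
    have hj : (j.factorial : ℝ) ≠ 0 := by positivity
    have : ((j : ℝ) + 2) ≠ 0 := by positivity
    rw [← mul_right_inj' this, h]
    simp only [risingFactorial_succ, Nat.factorial_succ]
    push_cast
    field_simp
    ring

lemma risingFactorial_natCast_succ (e j : ℕ) :
    risingFactorial ((e : ℝ) + 1) j = j.factorial * ((j + e).choose j : ℝ) := by
  induction j with
  | zero => simp [risingFactorial]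
  | succ j ih =>
    rw [risingFactorial_succ, ih]
    have h := Nat.add_one_mul_choose_eq (j + e) j
    rw [show j + e + 1 = j + 1 + e by ring] at h
    have h' : ((j : ℝ) + 1 + e) * (j + e).choose j = (j + 1 + e).choose (j + 1) * ((j : ℝ) + 1) := by
      exact_mod_cast h
    rw [Nat.factorial_succ]
    push_cast
    linear_combination (j.factorial : ℝ) * h'

lemma cdim_eq (e j : ℕ) :
    (cdim (e + 3) j : ℝ) * (e + 1) = (2 * j + e + 1) * ((j + e).choose j : ℝ) := by
  rcases j with _ | i
  · simp [cdim]
  · have h1 : (i + 1 + (e + 3) - 2) = i + e + 1 + 1 := by omega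
    have h2 : (i + 1 + (e + 3) - 3) = i + e + 1 := by omega
    rw [cdim, if_neg (by omega), h1, h2, Nat.add_sub_cancel, Nat.choose_succ_succ]
    have h := Nat.choose_succ_right_eq (i + e + 1) i
    rw [show i + e + 1 - i = e + 1 by omega] at h
    have h' : ((i + e + 1).choose (i + 1) : ℝ) * (i + 1) = (i + e + 1).choose i * (e + 1) := by
      exact_mod_cast h
    rw [show i + 1 + e = i + e + 1 by ring]
    push_cast
    linear_combination -2 * h'

/-- `c_{j,d} C̃_j^{(d-2)/2}`, the (unnormalized) reproducing kernel of `ℋ_{j,d}`. -/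
def zonal (d j : ℕ) (t : ℝ) : ℝ := (cdim d j : ℝ) * gegenbauerN (((d : ℝ) - 2) / 2) j t

/-- The lower coefficient in the three-term recurrence of `zonal`. -/
def zonalCoeff (b : ℝ) (j : ℕ) : ℝ := if j = 0 then 1 else (j + 2 * b) / (2 * (j + b))

lemma cdim_two_succ (j : ℕ) : cdim 2 (j + 1) = 2 := by simp [cdim]

lemma zonal_eq_gegenbauer (e j : ℕ) (t : ℝ) :
    zonal (e + 3) j t = (j + ((e : ℝ) + 1) / 2) / (((e : ℝ) + 1) / 2) *
      gegenbauer (((e : ℝ) + 1) / 2) j t := by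
  have hb : (((e + 3 : ℕ) : ℝ) - 2) / 2 = ((e : ℝ) + 1) / 2 := by push_cast; ring
  have hb0 : ((e : ℝ) + 1) / 2 ≠ 0 := by positivity
  have h1 : gegenbauer (((e : ℝ) + 1) / 2) j 1 = ((j + e).choose j : ℝ) := by
    have hj : (j.factorial : ℝ) ≠ 0 := by positivity
    rw [gegenbauer_at_one, show 2 * (((e : ℝ) + 1) / 2) = (e : ℝ) + 1 by ring,
      risingFactorial_natCast_succ]
    field_simp
  have hc : ((j + e).choose j : ℝ) ≠ 0 := by
    have := Nat.choose_pos (Nat.le_add_right j e)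
    positivity
  have h := cdim_eq e j
  have he : (e : ℝ) + 1 ≠ 0 := by positivity
  have h' : (cdim (e + 3) j : ℝ) = (2 * j + e + 1) * ((j + e).choose j : ℝ) / (e + 1) := by
    field_simp; linarith
  rw [zonal, hb, gegenbauerN, if_neg hb0, h1, h']
  field_simp
  ring

lemma zonal_zero (d : ℕ) (t : ℝ) : zonal d 0 t = 1 := by
  by_cases h : ((d : ℝ) - 2) / 2 = 0 <;> simp [zonal, cdim, gegenbauerN, h, gegenbauer_zero]

lemma zonal_one {d : ℕ} (hd : 2 ≤ d) (t : ℝ) : zonal d 1 t = d * t := by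
  obtain ⟨e, rfl⟩ := Nat.exists_eq_add_of_le' hd
  rcases e with _ | e
  · simp [zonal, cdim_two_succ, gegenbauerN]
  · rw [zonal_eq_gegenbauer, gegenbauer_one]
    push_cast
    have he : (e : ℝ) + 1 ≠ 0 := by positivity
    field_simp
    ring

lemma zonal_rec {d : ℕ} (hd : 2 ≤ d) (j : ℕ) (t : ℝ) :
    ((j : ℝ) + 2) * zonal d (j + 2) t = 2 * (j + 2 + ((d : ℝ) - 2) / 2) *
      (t * zonal d (j + 1) t - zonalCoeff (((d : ℝ) - 2) / 2) j * zonal d j t) := by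
  obtain ⟨e, rfl⟩ := Nat.exists_eq_add_of_le' hd
  rcases e with _ | e
  · have h := Polynomial.Chebyshev.T_add_two ℝ (j : ℤ)
    have h' := congrArg (Polynomial.eval t) h
    simp only [Polynomial.eval_sub, Polynomial.eval_mul, Polynomial.eval_ofNat,
      Polynomial.eval_X] at h'
    have hz : (((0 + 2 : ℕ) : ℝ) - 2) / 2 = 0 := by norm_num
    simp only [zonal, hz, gegenbauerN, if_true]
    push_cast
    rw [h']
    rcases j with _ | j
    · simp [cdim, zonalCoeff]; ring
    · simp only [cdim_two_succ, zonalCoeff]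
      have : (j : ℝ) + 1 ≠ 0 := by positivity
      push_cast
      simp
      field_simp
  · have hb : (((e + 1 + 2 : ℕ) : ℝ) - 2) / 2 = ((e : ℝ) + 1) / 2 := by push_cast; ring
    have hb0 : ((e : ℝ) + 1) / 2 ≠ 0 := by positivity
    rw [hb, zonal_eq_gegenbauer, zonal_eq_gegenbauer, zonal_eq_gegenbauer]
    have hj : (j : ℝ) + ((e : ℝ) + 1) / 2 ≠ 0 := by positivity
    have hc : zonalCoeff (((e : ℝ) + 1) / 2) j * ((j + ((e : ℝ) + 1) / 2) / (((e : ℝ) + 1) / 2)) =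
        (j + 2 * (((e : ℝ) + 1) / 2)) / (2 * (((e : ℝ) + 1) / 2)) := by
      rcases j with _ | j
      · simp [zonalCoeff]; field_simp
      · rw [zonalCoeff, if_neg (by omega)]
        field_simp
    rw [← mul_assoc (zonalCoeff _ _), hc]
    have h := gegenbauer_rec (((e : ℝ) + 1) / 2) j t
    generalize ((e : ℝ) + 1) / 2 = β at *
    push_cast
    field_simp
    linear_combination ((j : ℝ) + 2 + β) * h

lemma mul_zonal_succ {d : ℕ} (hd : 2 ≤ d) (j : ℕ) (t : ℝ) :
    t * zonal d (j + 1) t = (j + 2) / (2 * (j + 2 + ((d : ℝ) - 2) / 2)) * zonal d (j + 2) t +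
      zonalCoeff (((d : ℝ) - 2) / 2) j * zonal d j t := by
  have h := zonal_rec hd j t
  have hd' : (2 : ℝ) ≤ d := by exact_mod_cast hd
  have : (j : ℝ) + 2 + ((d : ℝ) - 2) / 2 ≠ 0 := by
    have : 0 ≤ ((d : ℝ) - 2) / 2 := by linarith
    positivity
  generalize ((d : ℝ) - 2) / 2 = b at *
  rw [div_mul_eq_mul_div, h]
  field_simp
  ring

lemma zonalCoeff_nonneg {b : ℝ} (hb : 0 ≤ b) (j : ℕ) : 0 ≤ zonalCoeff b j := by
  unfold zonalCoeff; split_ifs <;> positivity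

lemma zonalCoeff_le_one {b : ℝ} (hb : 0 ≤ b) (j : ℕ) : zonalCoeff b j ≤ 1 := by
  unfold zonalCoeff
  split_ifs with h
  · exact le_rfl
  · have : 0 < (j : ℝ) := by exact_mod_cast Nat.pos_of_ne_zero h
    rw [div_le_one (by positivity)]
    linarith

lemma abs_zonal_le {d : ℕ} (hd : 2 ≤ d) (j : ℕ) {t : ℝ} (ht : |t| ≤ 1) :
    |zonal d j t| ≤ ((d : ℝ) + 2) ^ j := by
  have hd' : (2 : ℝ) ≤ d := by exact_mod_cast hd
  induction j using Nat.twoStepInduction with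
  | zero => simp [zonal_zero]
  | one =>
    rw [zonal_one hd, abs_mul, Nat.abs_cast, pow_one]
    nlinarith [abs_nonneg t]
  | more j ih1 ih2 =>
    have hb : 0 ≤ ((d : ℝ) - 2) / 2 := by linarith
    have h := zonal_rec hd j t
    have hj : (0 : ℝ) < (j : ℝ) + 2 := by positivity
    set b := ((d : ℝ) - 2) / 2 with hbdef
    have hdb : (d : ℝ) = 2 * b + 2 := by rw [hbdef]; ring
    have h1 : |t * zonal d (j + 1) t - zonalCoeff b j * zonal d j t| ≤
        ((d : ℝ) + 2) ^ (j + 1) + ((d : ℝ) + 2) ^ j := by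
      refine (abs_sub _ _).trans (add_le_add ?_ ?_)
      · rw [abs_mul]
        exact (mul_le_of_le_one_left (abs_nonneg _) ht).trans ih2
      · rw [abs_mul, abs_of_nonneg (zonalCoeff_nonneg hb j)]
        exact (mul_le_of_le_one_left (abs_nonneg _) (zonalCoeff_le_one hb j)).trans ih1
    have h2 : ((j : ℝ) + 2) * |zonal d (j + 2) t| ≤
        2 * (j + 2 + b) * (((d : ℝ) + 2) ^ (j + 1) + ((d : ℝ) + 2) ^ j) := by
      have : ((j : ℝ) + 2) * |zonal d (j + 2) t| = |((j : ℝ) + 2) * zonal d (j + 2) t| := by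
        rw [abs_mul, abs_of_pos hj]
      rw [this, h, abs_mul, abs_of_nonneg (by positivity : (0:ℝ) ≤ 2 * (j + 2 + b))]
      gcongr
    have h3 : 2 * (j + 2 + b) * (((d : ℝ) + 2) ^ (j + 1) + ((d : ℝ) + 2) ^ j) ≤
        ((j : ℝ) + 2) * ((d : ℝ) + 2) ^ (j + 2) := by
      have hp : (0 : ℝ) ≤ ((d : ℝ) + 2) ^ j := by positivity
      have : 2 * (j + 2 + b) * ((d : ℝ) + 2 + 1) ≤ ((j : ℝ) + 2) * ((d : ℝ) + 2) ^ 2 := by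
        rw [hdb]
        have hj0 : (0 : ℝ) ≤ j := by positivity
        nlinarith [mul_nonneg hj0 hb, mul_nonneg hj0 (mul_nonneg hb hb), mul_nonneg hb hb]
      calc _ = 2 * (j + 2 + b) * ((d : ℝ) + 2 + 1) * ((d : ℝ) + 2) ^ j := by ring
        _ ≤ ((j : ℝ) + 2) * ((d : ℝ) + 2) ^ 2 * ((d : ℝ) + 2) ^ j := by gcongr
        _ = _ := by ring
    exact le_of_mul_le_mul_left (h2.trans h3) hj

/-- Coefficients in the expansion of monomials in zonal functions, extended by zero. -/
def monoCoeff (b : ℝ) (n m : ℕ) : ℝ :=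
  if 2 * m ≤ n then 1 / ((m.factorial : ℝ) * Real.Gamma ((n : ℝ) - m + (b + 1))) else 0

lemma monoCoeff_zero_rec {b : ℝ} (hb : 0 ≤ b) (n : ℕ) :
    ((n : ℝ) + 1) * monoCoeff b (n + 1) 0 =
      ((n : ℝ) + 1) / (n + 1 + b) * monoCoeff b n 0 := by
  have hg : Real.Gamma ((n : ℝ) + (b + 1)) ≠ 0 := (Real.Gamma_pos_of_pos (by positivity)).ne'
  have hn : (n : ℝ) + (b + 1) ≠ 0 := by positivity
  have h : Real.Gamma ((n : ℝ) + 1 + (b + 1)) = (n + (b + 1)) * Real.Gamma ((n : ℝ) + (b + 1)) := by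
    rw [← Real.Gamma_add_one hn]; ring_nf
  have hn' : (n : ℝ) + 1 + b ≠ 0 := by positivity
  simp only [monoCoeff]
  push_cast
  simp only [zero_le, if_true, Nat.factorial_zero, sub_zero, Nat.cast_one, one_mul, h]
  field_simp
  ring

lemma monoCoeff_succ_rec {b : ℝ} (hb : 0 ≤ b) (n m : ℕ) (h : 2 * (m + 1) ≤ n + 1) :
    ((n : ℝ) + 1) * monoCoeff b (n + 1) (m + 1) =
      ((n + 1 - 2 * (m + 1) : ℕ) : ℝ) / (((n + 1 - 2 * (m + 1) : ℕ) : ℝ) + b) *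
        monoCoeff b n (m + 1) +
      2 * (zonalCoeff b (n + 1 - 2 * (m + 1)) * monoCoeff b n m) := by
  obtain ⟨k, hk⟩ := Nat.exists_eq_add_of_le h
  have hn : n = 2 * m + 1 + k := by omega
  subst hn
  have e1 : 2 * m + 1 + k + 1 - 2 * (m + 1) = k := by omega
  rw [e1]
  have hz : (m : ℝ) + k + (b + 1) ≠ 0 := by positivity
  have hg : Real.Gamma ((m : ℝ) + k + (b + 1)) ≠ 0 := (Real.Gamma_pos_of_pos (by positivity)).ne'
  have hm : (m.factorial : ℝ) ≠ 0 := by positivity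
  have hG : Real.Gamma ((m : ℝ) + k + 1 + (b + 1)) =
      (m + k + (b + 1)) * Real.Gamma ((m : ℝ) + k + (b + 1)) := by
    rw [← Real.Gamma_add_one hz]; ring_nf
  have g1 : (((2 * m + 1 + k + 1 : ℕ) : ℝ) - ((m + 1 : ℕ) : ℝ) + (b + 1)) =
      (m : ℝ) + k + 1 + (b + 1) := by push_cast; ring
  have g2 : (((2 * m + 1 + k : ℕ) : ℝ) - ((m + 1 : ℕ) : ℝ) + (b + 1)) =
      (m : ℝ) + k + (b + 1) := by push_cast; ring
  have g3 : (((2 * m + 1 + k : ℕ) : ℝ) - (m : ℝ) + (b + 1)) =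
      (m : ℝ) + k + 1 + (b + 1) := by push_cast; ring
  rcases k with _ | k
  · have c1 : ¬ 2 * (m + 1) ≤ 2 * m + 1 + 0 := by omega
    have c2 : 2 * m ≤ 2 * m + 1 + 0 := by omega
    simp only [monoCoeff, g1, g3, c1, c2, h, if_true, if_false, hG, zonalCoeff, Nat.factorial_succ]
    push_cast
    field_simp
    ring
  · have c1 : 2 * (m + 1) ≤ 2 * m + 1 + (k + 1) := by omega
    have c2 : 2 * m ≤ 2 * m + 1 + (k + 1) := by omega
    simp only [monoCoeff, g1, g2, g3, c1, c2, h, if_true, hG, zonalCoeff, Nat.factorial_succ]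
    rw [if_neg (by omega)]
    have hkb : ((k : ℝ) + 1 + b) ≠ 0 := by positivity
    push_cast at hz hg ⊢
    field_simp
    ring

lemma pow_expansion_aux {d : ℕ} (hd : 2 ≤ d) (n : ℕ) (t : ℝ) :
    2 ^ n * t ^ n = (n.factorial : ℝ) * Real.Gamma ((d : ℝ) / 2) *
      ∑ m ∈ Finset.range (n + 1), monoCoeff (((d : ℝ) - 2) / 2) n m * zonal d (n - 2 * m) t := by
  have hd' : (2 : ℝ) ≤ d := by exact_mod_cast hd
  have hb : 0 ≤ ((d : ℝ) - 2) / 2 := by linarith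
  set b := ((d : ℝ) - 2) / 2 with hbdef
  have hdb : (d : ℝ) / 2 = b + 1 := by rw [hbdef]; ring
  have hdb' : (d : ℝ) = 2 * (1 + b) := by rw [hbdef]; ring
  induction n with
  | zero =>
    have : Real.Gamma (b + 1) ≠ 0 := (Real.Gamma_pos_of_pos (by positivity)).ne'
    simp [monoCoeff, zonal_zero, hdb, this]
  | succ n ih =>
    have hmul : ∀ m ∈ Finset.range (n + 1), 2 * t * (monoCoeff b n m * zonal d (n - 2 * m) t) =
        ((n + 1 - 2 * m : ℕ) : ℝ) / (((n + 1 - 2 * m : ℕ) : ℝ) + b) * monoCoeff b n m *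
          zonal d (n + 1 - 2 * m) t +
        2 * (zonalCoeff b (n + 1 - 2 * (m + 1)) * monoCoeff b n m) *
          (if 2 * (m + 1) ≤ n + 1 then zonal d (n + 1 - 2 * (m + 1)) t else 0) := by
      intro m _
      by_cases h : 2 * m ≤ n
      · obtain ⟨j, hj⟩ := Nat.exists_eq_add_of_le h
        rcases j with _ | j
        · have e1 : n - 2 * m = 0 := by omega
          have e2 : n + 1 - 2 * m = 1 := by omega
          have e3 : ¬ 2 * (m + 1) ≤ n + 1 := by omega
          have hb1 : 1 + b ≠ 0 := by positivity
          rw [e1, e2, if_neg e3, zonal_zero, zonal_one hd, hdb']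
          push_cast
          field_simp
          ring
        · have e1 : n - 2 * m = j + 1 := by omega
          have e2 : n + 1 - 2 * m = j + 2 := by omega
          have e3 : 2 * (m + 1) ≤ n + 1 := by omega
          have e4 : n + 1 - 2 * (m + 1) = j := by omega
          have hb1 : (j : ℝ) + 2 + b ≠ 0 := by positivity
          have hms := mul_zonal_succ hd j t
          rw [← hbdef] at hms
          rw [e1, e2, if_pos e3, e4]
          have : 2 * t * (monoCoeff b n m * zonal d (j + 1) t) =
            2 * monoCoeff b n m * (t * zonal d (j + 1) t) := by ring
          rw [this, hms]
          push_cast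
          field_simp
      · simp [monoCoeff, h]
    have hrec : ((n : ℝ) + 1) * ∑ m ∈ Finset.range (n + 2),
          monoCoeff b (n + 1) m * zonal d (n + 1 - 2 * m) t =
        2 * t * ∑ m ∈ Finset.range (n + 1), monoCoeff b n m * zonal d (n - 2 * m) t := by
      rw [Finset.mul_sum (Finset.range (n + 1)), Finset.sum_congr rfl hmul, Finset.sum_add_distrib]
      have hlast : ∑ m ∈ Finset.range (n + 1),
          ((n + 1 - 2 * m : ℕ) : ℝ) / (((n + 1 - 2 * m : ℕ) : ℝ) + b) * monoCoeff b n m *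
          zonal d (n + 1 - 2 * m) t = ∑ m ∈ Finset.range (n + 2),
          ((n + 1 - 2 * m : ℕ) : ℝ) / (((n + 1 - 2 * m : ℕ) : ℝ) + b) * monoCoeff b n m *
          zonal d (n + 1 - 2 * m) t := by
        rw [Finset.sum_range_succ _ (n + 1)]
        have : ¬ 2 * (n + 1) ≤ n := by omega
        simp [monoCoeff, this]
      rw [hlast, Finset.mul_sum, Finset.sum_range_succ', Finset.sum_range_succ' _ (n + 1),
        add_right_comm, ← Finset.sum_add_distrib]
      congr 1
      · refine Finset.sum_congr rfl fun m _ => ?_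
        by_cases h : 2 * (m + 1) ≤ n + 1
        · rw [if_pos h, ← mul_assoc, monoCoeff_succ_rec hb n m h]
          ring
        · have h' : ¬ 2 * (m + 1) ≤ n := by omega
          simp [monoCoeff, h, h']
      · rw [← mul_assoc, monoCoeff_zero_rec hb]
        simp
    calc (2 : ℝ) ^ (n + 1) * t ^ (n + 1) = 2 * t * (2 ^ n * t ^ n) := by ring
      _ = (n.factorial : ℝ) * Real.Gamma ((d : ℝ) / 2) * (2 * t * ∑ m ∈ Finset.range (n + 1),
          monoCoeff b n m * zonal d (n - 2 * m) t) := by rw [ih]; ring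
      _ = _ := by
        rw [← hrec, Nat.factorial_succ]
        push_cast
        ring

/-- Expansion of a monomial in the zonal functions. -/
lemma pow_expansion {d : ℕ} (hd : 2 ≤ d) (n : ℕ) (t : ℝ) :
    t ^ n / n.factorial = Real.Gamma ((d : ℝ) / 2) / 2 ^ n *
      ∑ m ∈ Finset.range (n / 2 + 1),
        1 / ((m.factorial : ℝ) * Real.Gamma ((n : ℝ) - m + (d : ℝ) / 2)) *
          zonal d (n - 2 * m) t := by
  have h := pow_expansion_aux hd n t
  rw [sum_range_eq_of_eq_zero (N := n / 2 + 1) (by omega)] at h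
  · have hs : ∑ m ∈ Finset.range (n / 2 + 1),
        monoCoeff (((d : ℝ) - 2) / 2) n m * zonal d (n - 2 * m) t =
        ∑ m ∈ Finset.range (n / 2 + 1),
        1 / ((m.factorial : ℝ) * Real.Gamma ((n : ℝ) - m + (d : ℝ) / 2)) *
          zonal d (n - 2 * m) t := by
      refine Finset.sum_congr rfl fun m hm => ?_
      have h2 : 2 * m ≤ n := by have := Finset.mem_range.1 hm; omega
      rw [monoCoeff, if_pos h2, show ((d : ℝ) - 2) / 2 + 1 = (d : ℝ) / 2 by ring]
    rw [hs] at h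
    have hn : (n.factorial : ℝ) ≠ 0 := by positivity
    rw [div_mul_eq_mul_div, div_eq_div_iff hn (by positivity)]
    linear_combination h
  · intro m hm
    have : ¬ 2 * m ≤ n := by omega
    simp [monoCoeff, this]

/-- The scalar kernel of the characteristic exponent. -/
def stableKernel (α s : ℝ) : ℂ :=
  ((|s| ^ α : ℝ) : ℂ) *
    (1 - Complex.I * (Real.tan (Real.pi * α / 2) : ℂ) * (Real.sign s : ℂ))

lemma abs_mul_sign (s : ℝ) : |s| * Real.sign s = s := by
  rcases lt_trichotomy s 0 with h | h | h
  · rw [Real.sign_of_neg h, abs_of_neg h]; ring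
  · simp [h]
  · rw [Real.sign_of_pos h, abs_of_pos h]; ring

lemma stableKernel_eq {α : ℝ} (hα : 1 < α) (s : ℝ) :
    stableKernel α s = ((|s| ^ (α - 1) : ℝ) : ℂ) *
      ((|s| : ℝ) - Complex.I * (Real.tan (Real.pi * α / 2) : ℂ) * (s : ℂ)) := by
  have h : |s| ^ α = |s| ^ (α - 1) * |s| := by
    rcases eq_or_ne s 0 with rfl | hs
    · simp [Real.zero_rpow (by linarith : α ≠ 0)]
    · rw [← Real.rpow_add_one (abs_ne_zero.2 hs)]; ring_nf
  have h2 : ((|s| : ℝ) : ℂ) * (Real.sign s : ℂ) = (s : ℂ) := by exact_mod_cast abs_mul_sign s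
  rw [stableKernel, h]
  push_cast
  linear_combination -((|s| ^ (α - 1) : ℝ) : ℂ) * Complex.I * Complex.tan (Real.pi * α / 2) * h2

lemma continuous_stableKernel {α : ℝ} (hα : 1 < α) : Continuous (stableKernel α) := by
  rw [funext (stableKernel_eq hα)]
  have : Continuous fun s : ℝ => |s| ^ (α - 1) :=
    continuous_abs.rpow_const fun s => Or.inr (by linarith)
  fun_prop

lemma stableKernel_mul {α r : ℝ} (hr : 0 < r) (s : ℝ) :
    stableKernel α (r * s) = ((r ^ α : ℝ) : ℂ) * stableKernel α s := by
  have hs : Real.sign (r * s) = Real.sign s := by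
    rcases lt_trichotomy s 0 with h | h | h
    · rw [Real.sign_of_neg h, Real.sign_of_neg (mul_neg_of_pos_of_neg hr h)]
    · simp [h]
    · rw [Real.sign_of_pos h, Real.sign_of_pos (mul_pos hr h)]
  rw [stableKernel, stableKernel, hs, abs_mul, abs_of_pos hr,
    Real.mul_rpow hr.le (abs_nonneg _)]
  push_cast
  ring

lemma stableKernel_re (α s : ℝ) : (stableKernel α s).re = |s| ^ α := by
  rw [stableKernel, Complex.re_ofReal_mul]
  generalize Real.tan (Real.pi * α / 2) = c
  simp

lemma charExp_eq (d : ℕ) (α : ℝ) (Λ : Measure (Sph d)) (z : Ed d) :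
    charExp d α Λ z = ∫ v, stableKernel α ⟪z, (v : Ed d)⟫ ∂Λ := rfl

lemma charExp_smul {d : ℕ} {α : ℝ} (Λ : Measure (Sph d)) {r : ℝ} (hr : 0 < r) (z : Ed d) :
    charExp d α Λ (r • z) = ((r ^ α : ℝ) : ℂ) * charExp d α Λ z := by
  simp only [charExp_eq, real_inner_smul_left, stableKernel_mul hr]
  exact integral_const_mul _ _

lemma norm_sph {d : ℕ} (u : Sph d) : ‖(u : Ed d)‖ = 1 := by simp

lemma abs_inner_sph_le {d : ℕ} (u v : Sph d) : |⟪(u : Ed d), (v : Ed d)⟫| ≤ 1 := by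
  simpa using abs_real_inner_le_norm (u : Ed d) (v : Ed d)

lemma exists_stableKernel_bound {α : ℝ} (hα : 1 < α) :
    ∃ C, ∀ s : ℝ, |s| ≤ 1 → ‖stableKernel α s‖ ≤ C := by
  obtain ⟨C, hC⟩ := (isCompact_Icc (a := (-1 : ℝ)) (b := 1)).exists_bound_of_continuousOn
    (continuous_stableKernel hα).continuousOn
  exact ⟨C, fun s hs => hC s (abs_le.1 hs)⟩

lemma continuous_Vfun {d : ℕ} {α : ℝ} (hα : 1 < α) (Λ : Measure (Sph d)) [IsFiniteMeasure Λ] :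
    Continuous (Vfun d α Λ) := by
  obtain ⟨C, hC⟩ := exists_stableKernel_bound hα
  have hk := continuous_stableKernel hα
  change Continuous fun u : Sph d => ∫ v, stableKernel α ⟪(u : Ed d), (v : Ed d)⟫ ∂Λ
  refine continuous_of_dominated (bound := fun _ => C) (fun u => ?_)
    (fun u => .of_forall fun v => hC _ (abs_inner_sph_le u v)) (integrable_const C)
    (.of_forall fun v => ?_)
  · exact (hk.comp (by fun_prop)).aestronglyMeasurable
  · exact hk.comp (by fun_prop)

lemma integrable_stableKernel {d : ℕ} {α : ℝ} (hα : 1 < α) (Λ : Measure (Sph d))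
    [IsFiniteMeasure Λ] (u : Sph d) :
    Integrable (fun v : Sph d => stableKernel α ⟪(u : Ed d), (v : Ed d)⟫) Λ := by
  obtain ⟨C, hC⟩ := exists_stableKernel_bound hα
  exact .of_bound ((continuous_stableKernel hα).comp (by fun_prop)).aestronglyMeasurable C
    (.of_forall fun v => hC _ (abs_inner_sph_le u v))

lemma Vfun_re {d : ℕ} {α : ℝ} (hα : 1 < α) (Λ : Measure (Sph d)) [IsFiniteMeasure Λ] (u : Sph d) :
    (Vfun d α Λ u).re = ∫ v, |⟪(u : Ed d), (v : Ed d)⟫| ^ α ∂Λ := by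
  simp only [← stableKernel_re]
  exact (integral_re (integrable_stableKernel hα Λ u)).symm

lemma charFun_eq_exp {d : ℕ} {α : ℝ} {Λ : Measure (Sph d)} {μ : Measure (Ed d)}
    (hμ : IsStableChar d α Λ μ) (z : Ed d) : charFun μ z = Complex.exp (-charExp d α Λ z) := by
  rw [← hμ z, charFun_apply]
  congr! 3 with x
  rw [real_inner_comm, mul_comm]

lemma Vfun_re_pos {d : ℕ} {α : ℝ} (hα : 1 < α) (Λ : Measure (Sph d)) [IsFiniteMeasure Λ]
    (μ : Measure (Ed d)) [IsProbabilityMeasure μ] (hμ : IsStableChar d α Λ μ)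
    (hnd : Nondegenerate d μ) (u : Sph d) : 0 < (Vfun d α Λ u).re := by
  by_contra hle
  have hint : Integrable (fun v : Sph d => |⟪(u : Ed d), (v : Ed d)⟫| ^ α) Λ := by
    simp only [← stableKernel_re]
    exact (integrable_stableKernel hα Λ u).re
  have h0 : ∫ v, |⟪(u : Ed d), (v : Ed d)⟫| ^ α ∂Λ = 0 := by
    rw [Vfun_re hα] at hle
    exact le_antisymm (not_lt.1 hle) (integral_nonneg fun v => by positivity)
  rw [integral_eq_zero_iff_of_nonneg (fun v => by positivity) hint] at h0
  have hV : charExp d α Λ u = 0 := by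
    rw [charExp_eq]
    refine integral_eq_zero_of_ae ?_
    filter_upwards [h0] with v hv
    have hv' : |⟪(u : Ed d), (v : Ed d)⟫| ^ α = 0 := hv
    simp [stableKernel, hv']
  have hV' : ∀ t : ℝ, charExp d α Λ (t • (u : Ed d)) = 0 := by
    intro t
    rw [charExp_eq]
    refine integral_eq_zero_of_ae ?_
    filter_upwards [h0] with v hv
    have hv' : |⟪(u : Ed d), (v : Ed d)⟫| ^ α = 0 := hv
    simp [stableKernel, real_inner_smul_left, abs_mul,
      Real.mul_rpow (abs_nonneg t) (abs_nonneg ⟪(u : Ed d), (v : Ed d)⟫), hv']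
  have hm : Measurable fun x : Ed d => ⟪(u : Ed d), x⟫ := by fun_prop
  have hdirac : μ.map (fun x : Ed d => ⟪(u : Ed d), x⟫) = Measure.dirac 0 := by
    have : IsProbabilityMeasure (μ.map fun x : Ed d => ⟪(u : Ed d), x⟫) :=
      Measure.isProbabilityMeasure_map hm.aemeasurable
    refine Measure.ext_of_charFun (funext fun t => ?_)
    have h1 : charFun μ (t • (u : Ed d)) = 1 := by rw [charFun_eq_exp hμ, hV' t]; simp
    rw [charFun_dirac, charFun_apply, integral_map hm.aemeasurable (by fun_prop)]
    rw [charFun_apply] at h1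
    rw [inner_zero_left]
    simp only [Complex.ofReal_zero, zero_mul, Complex.exp_zero]
    rw [← h1]
    congr! 4 with x
    rw [real_inner_smul_right, real_inner_comm x]
    simp
  have hW : (Submodule.span ℝ {(u : Ed d)})ᗮ ≠ ⊤ := by
    intro h
    rw [Submodule.orthogonal_eq_top_iff, Submodule.span_singleton_eq_bot] at h
    have := norm_sph u
    simp [h] at this
  have hlt := hnd 0 _ hW
  have hset : (fun x => (0 : Ed d) + x) '' ((Submodule.span ℝ {(u : Ed d)})ᗮ : Set (Ed d)) =
      (fun x : Ed d => ⟪(u : Ed d), x⟫) ⁻¹' {0} := by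
    ext x
    simp [Submodule.mem_orthogonal_singleton_iff_inner_right]
  rw [hset, ← Measure.map_apply hm (measurableSet_singleton _), hdirac] at hlt
  simp at hlt

lemma nonempty_sph {d : ℕ} (hd : 2 ≤ d) : Nonempty (Sph d) :=
  ⟨⟨EuclideanSpace.single ⟨0, by omega⟩ 1, by simp⟩⟩

lemma exists_rho {d : ℕ} (hd : 2 ≤ d) {α : ℝ} (hα : 1 < α) (Λ : Measure (Sph d))
    [IsFiniteMeasure Λ] (hpos : ∀ u, 0 < (Vfun d α Λ u).re) (R : ℝ)
    (hR : (⨆ u : Sph d, ‖Vfun d α Λ u‖ ^ 2 / (2 * (Vfun d α Λ u).re)) < R) :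
    ∃ ρ, 0 ≤ ρ ∧ ρ < R ∧ ∀ u, ‖(R : ℂ) - Vfun d α Λ u‖ ≤ ρ := by
  have hV := continuous_Vfun hα Λ
  have hne := nonempty_sph hd
  have hcont : Continuous fun u : Sph d => ‖Vfun d α Λ u‖ ^ 2 / (2 * (Vfun d α Λ u).re) := by
    refine (hV.norm.pow 2).div₀ ?_ fun u => by have := hpos u; positivity
    exact continuous_const.mul (Complex.continuous_re.comp hV)
  have hbdd : BddAbove (Set.range fun u : Sph d => ‖Vfun d α Λ u‖ ^ 2 / (2 * (Vfun d α Λ u).re)) :=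
    (isCompact_range hcont).bddAbove
  have hlt : ∀ u : Sph d, ‖Vfun d α Λ u‖ ^ 2 / (2 * (Vfun d α Λ u).re) < R := fun u =>
    (le_ciSup hbdd u).trans_lt hR
  have hR0 : 0 < R := by
    obtain ⟨u⟩ := hne
    refine lt_of_le_of_lt ?_ (hlt u)
    have := hpos u
    positivity
  have hlt' : ∀ u : Sph d, ‖(R : ℂ) - Vfun d α Λ u‖ < R := by
    intro u
    have h := hlt u
    have hp := hpos u
    rw [div_lt_iff₀ (by positivity), Complex.sq_norm, Complex.normSq_apply] at h
    refine lt_of_pow_lt_pow_left₀ 2 hR0.le ?_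
    rw [Complex.sq_norm, Complex.normSq_apply]
    simp only [Complex.sub_re, Complex.sub_im, Complex.ofReal_re, Complex.ofReal_im]
    nlinarith
  obtain ⟨u, -, hu⟩ := isCompact_univ.exists_isMaxOn Set.univ_nonempty
    (f := fun u : Sph d => ‖(R : ℂ) - Vfun d α Λ u‖) (by fun_prop)
  exact ⟨_, norm_nonneg _, hlt' u, fun v => hu (Set.mem_univ v)⟩

/-- The radial measure `r ^ (d - 1) dr` on `(0, ∞)`, as a measure on `ℝ`. -/
def radMeas (d : ℕ) : Measure ℝ :=
  (volume.restrict (Set.Ioi 0)).withDensity fun r => ENNReal.ofReal (r ^ (d - 1))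

instance (d : ℕ) : SigmaFinite (radMeas d) :=
  SigmaFinite.withDensity_ofReal _

instance (d : ℕ) : IsFiniteMeasure (ωd d) :=
  inferInstanceAs (IsFiniteMeasure (volume : Measure (Ed d)).toSphere)

lemma map_volumeIoiPow (d : ℕ) :
    (Measure.volumeIoiPow (d - 1)).map (Subtype.val : Set.Ioi (0 : ℝ) → ℝ) = radMeas d := by
  ext s hs
  rw [Measure.map_apply measurable_subtype_coe hs, Measure.volumeIoiPow, radMeas,
    withDensity_apply _ (measurable_subtype_coe hs), withDensity_apply _ hs,
    Measure.restrict_restrict hs]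
  rw [setLIntegral_subtype measurableSet_Ioi _ fun r : ℝ => ENNReal.ofReal (r ^ (d - 1)),
    Subtype.image_preimage_coe, Set.inter_comm]

lemma measurePreserving_polar {d : ℕ} (hd : 2 ≤ d) :
    MeasurePreserving (fun p : Sph d × ℝ => p.2 • (p.1 : Ed d)) ((ωd d).prod (radMeas d))
      volume := by
  have : NeZero d := ⟨by omega⟩
  refine ⟨by fun_prop, ?_⟩
  have hfin : Module.finrank ℝ (Ed d) - 1 = d - 1 := by simp
  have h1 := (volume : Measure (Ed d)).measurePreserving_homeomorphUnitSphereProd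
  rw [hfin] at h1
  have h2 := MeasurePreserving.symm (homeomorphUnitSphereProd (Ed d)).toMeasurableEquiv h1
  have h3 : MeasurePreserving (Subtype.val : ({0}ᶜ : Set (Ed d)) → Ed d)
      ((volume : Measure (Ed d)).comap Subtype.val) volume := by
    have := measurePreserving_subtype_coe (μa := (volume : Measure (Ed d)))
      (measurableSet_singleton (0 : Ed d)).compl
    rwa [restrict_compl_singleton] at this
  have h4 := (h3.comp h2).map_eq
  rw [← h4, ← map_volumeIoiPow, ωd]
  have h5 := Measure.map_prod_map (volume : Measure (Ed d)).toSphere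
    (Measure.volumeIoiPow (d - 1)) (measurable_id (α := Sph d))
    (measurable_subtype_coe (p := fun x : ℝ => x ∈ Set.Ioi 0))
  rw [Measure.map_id] at h5
  rw [h5, Measure.map_map (by fun_prop) (measurable_id.prodMap measurable_subtype_coe)]
  congr 1

lemma ae_radMeas_pos (d : ℕ) : ∀ᵐ r ∂(radMeas d), 0 < r := by
  have : ∀ᵐ r ∂(volume.restrict (Set.Ioi (0 : ℝ))), 0 < r := ae_restrict_mem measurableSet_Ioi
  exact withDensity_absolutelyContinuous _ _ this

lemma integral_radMeas {E : Type*} [NormedAddCommGroup E] [NormedSpace ℝ E] (d : ℕ)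
    (f : ℝ → E) : ∫ r, f r ∂(radMeas d) = ∫ r in Set.Ioi 0, r ^ (d - 1) • f r := by
  rw [radMeas, integral_withDensity_eq_integral_toReal_smul (by fun_prop) (by simp)]
  refine setIntegral_congr_fun measurableSet_Ioi fun r hr => ?_
  have : (0 : ℝ) ≤ r ^ (d - 1) := pow_nonneg (Set.mem_Ioi.1 hr).le _
  simp [ENNReal.toReal_ofReal this]

lemma integrable_radMeas_iff {E : Type*} [NormedAddCommGroup E] [NormedSpace ℝ E] (d : ℕ)
    (f : ℝ → E) :
    Integrable f (radMeas d) ↔ IntegrableOn (fun r => r ^ (d - 1) • f r) (Set.Ioi 0) := by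
  rw [radMeas, integrable_withDensity_iff_integrable_smul' (by fun_prop) (by simp)]
  refine integrableOn_congr_fun (fun r hr => ?_) measurableSet_Ioi
  have : (0 : ℝ) ≤ r ^ (d - 1) := pow_nonneg (Set.mem_Ioi.1 hr).le _
  simp [ENNReal.toReal_ofReal this]

/-- Polar coordinates with the sphere integrated last. -/
lemma integral_polar {E : Type*} [NormedAddCommGroup E] [NormedSpace ℝ E] {d : ℕ} (hd : 2 ≤ d)
    {f : Ed d → E} (hf : Integrable f) :
    ∫ x, f x = ∫ u, ∫ r, f (r • (u : Ed d)) ∂(radMeas d) ∂(ωd d) := by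
  have h := measurePreserving_polar hd
  rw [← h.map_eq, integral_map h.measurable.aemeasurable
    (by rw [h.map_eq]; exact hf.aestronglyMeasurable)]
  exact integral_prod _ (h.integrable_comp_of_integrable hf)

/-- Polar coordinates with the radius integrated last. -/
lemma integral_polar' {E : Type*} [NormedAddCommGroup E] [NormedSpace ℝ E] {d : ℕ} (hd : 2 ≤ d)
    {f : Ed d → E} (hf : Integrable f) :
    ∫ x, f x = ∫ r, ∫ u, f (r • (u : Ed d)) ∂(ωd d) ∂(radMeas d) := by
  have h := measurePreserving_polar hd
  rw [← h.map_eq, integral_map h.measurable.aemeasurable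
    (by rw [h.map_eq]; exact hf.aestronglyMeasurable)]
  exact integral_prod_symm _ (h.integrable_comp_of_integrable hf)

lemma integrable_of_polar_bound {E : Type*} [NormedAddCommGroup E] {d : ℕ} (hd : 2 ≤ d)
    {f : Ed d → E} (hf : AEStronglyMeasurable f) {b : ℝ → ℝ} (hb : Integrable b (radMeas d))
    (hfb : ∀ (u : Sph d) (r : ℝ), 0 < r → ‖f (r • (u : Ed d))‖ ≤ b r) : Integrable f := by
  have h := measurePreserving_polar hd
  rw [← h.map_eq, integrable_map_measure (by rwa [h.map_eq]) h.measurable.aemeasurable]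
  have hb2 : Integrable (fun p : Sph d × ℝ => b p.2) ((ωd d).prod (radMeas d)) := hb.comp_snd _
  refine hb2.mono' (hf.comp_quasiMeasurePreserving h.quasiMeasurePreserving) ?_
  have h0 : ∀ᵐ p : Sph d × ℝ ∂((ωd d).prod (radMeas d)), 0 < p.2 :=
    Measure.quasiMeasurePreserving_snd.ae (ae_radMeas_pos d)
  filter_upwards [h0] with p hp using hfb _ _ hp

lemma exists_mul_le_rpow {α : ℝ} (hα : 1 < α) (B : ℝ) {δ : ℝ} (hδ : 0 < δ) :
    ∃ C : ℝ, ∀ r : ℝ, 0 < r → B * r ≤ δ * r ^ α + C := by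
  have hlim : Tendsto (fun r : ℝ => r ^ (α - 1)) atTop atTop := tendsto_rpow_atTop (by linarith)
  obtain ⟨r₀, h0, h⟩ := ((hlim.eventually_ge_atTop (|B| / δ)).and
    (eventually_gt_atTop 0)).exists
  refine ⟨|B| * r₀, fun r hr => ?_⟩
  have hBr : B * r ≤ |B| * r := mul_le_mul_of_nonneg_right (le_abs_self B) hr.le
  rcases le_total r r₀ with hle | hge
  · have : |B| * r ≤ |B| * r₀ := by gcongr
    have : 0 ≤ δ * r ^ α := by positivity
    linarith
  · have h1 : |B| / δ ≤ r ^ (α - 1) :=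
      h0.trans (Real.rpow_le_rpow h.le hge (by linarith))
    rw [div_le_iff₀ hδ] at h1
    have h2 : r ^ α = r ^ (α - 1) * r := by rw [← Real.rpow_add_one hr.ne']; ring_nf
    have h3 : |B| * r ≤ r ^ (α - 1) * δ * r := by gcongr
    have h4 : 0 ≤ |B| * r₀ := by positivity
    rw [h2]
    nlinarith

lemma integrable_pow_exp_rpow (d : ℕ) {α : ℝ} (hα : 1 < α) {δ : ℝ} (hδ : 0 < δ) (n : ℕ) :
    Integrable (fun r => r ^ n * Real.exp (-δ * r ^ α)) (radMeas d) := by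
  rw [integrable_radMeas_iff]
  have h := integrableOn_rpow_mul_exp_neg_mul_rpow (p := α) (s := ((d - 1 + n : ℕ) : ℝ)) (b := δ)
    (by have : (0 : ℝ) ≤ ((d - 1 + n : ℕ) : ℝ) := by positivity
        linarith) (by linarith) hδ
  refine h.congr_fun (fun r _ => ?_) measurableSet_Ioi
  simp only [Real.rpow_natCast, smul_eq_mul, pow_add]
  ring

lemma integrable_exp_mul_exp_rpow (d : ℕ) {α : ℝ} (hα : 1 < α) (B : ℝ) {δ : ℝ} (hδ : 0 < δ) :
    Integrable (fun r => Real.exp (B * r) * Real.exp (-δ * r ^ α)) (radMeas d) := by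
  obtain ⟨C, hC⟩ := exists_mul_le_rpow hα B (half_pos hδ)
  have h := ((integrable_pow_exp_rpow d hα (half_pos hδ) 0).const_mul (Real.exp C))
  refine h.mono' (by fun_prop) ?_
  filter_upwards [ae_radMeas_pos d] with r hr
  rw [Real.norm_of_nonneg (by positivity), pow_zero, one_mul, ← Real.exp_add, ← Real.exp_add]
  refine Real.exp_le_exp.2 ?_
  linarith [hC r hr]

lemma hasSum_of_eq {E : Type*} [AddCommMonoid E] [TopologicalSpace E] {f g : ℕ → E} {a b : E}
    (h : HasSum f a) (hfg : ∀ k, g k = f k) (hab : b = a) : HasSum g b := by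
  rw [hab, funext hfg]; exact h

/-- The coefficients `Γ(k + (n+d)/α) / (k! R ^ (k + (n+d)/α))`. -/
def radCoef (d : ℕ) (α R : ℝ) (n k : ℕ) : ℝ :=
  Real.Gamma ((k : ℝ) + ((n : ℝ) + d) / α) /
    ((Nat.factorial k : ℝ) * R ^ ((k : ℝ) + ((n : ℝ) + d) / α))

/-- The radial moments `∫ r ^ n exp (-r ^ α V) r ^ (d - 1) dr`. -/
def radMoment (d : ℕ) (α : ℝ) (n : ℕ) (V : ℂ) : ℂ :=
  ∫ r, ((r ^ n : ℝ) : ℂ) * Complex.exp (-(((r ^ α : ℝ) : ℂ) * V)) ∂(radMeas d)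

/-- The radial moments for a real exponent. -/
def radMomentR (d : ℕ) (α : ℝ) (n : ℕ) (δ : ℝ) : ℝ :=
  ∫ r, r ^ n * Real.exp (-δ * r ^ α) ∂(radMeas d)

lemma radCoef_nonneg (d : ℕ) {α R : ℝ} (hα : 1 < α) (hR : 0 ≤ R) (n k : ℕ) :
    0 ≤ radCoef d α R n k := by
  have : (0 : ℝ) ≤ (k : ℝ) + ((n : ℝ) + d) / α := by positivity
  exact div_nonneg (Real.Gamma_nonneg_of_nonneg this) (by positivity)

lemma radMomentR_nonneg (d : ℕ) (α : ℝ) (n : ℕ) (δ : ℝ) : 0 ≤ radMomentR d α n δ := by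
  refine integral_nonneg_of_ae ?_
  filter_upwards [ae_radMeas_pos d] with r hr
  change 0 ≤ r ^ n * Real.exp (-δ * r ^ α)
  positivity

lemma norm_exp_neg_rpow_mul_le {α r δ : ℝ} (hr : 0 < r) {V : ℂ} (hV : δ ≤ V.re) :
    ‖Complex.exp (-(((r ^ α : ℝ) : ℂ) * V))‖ ≤ Real.exp (-δ * r ^ α) := by
  rw [Complex.norm_exp, Complex.neg_re, Complex.re_ofReal_mul]
  refine Real.exp_le_exp.2 ?_
  have : 0 ≤ r ^ α := by positivity
  nlinarith

lemma integral_radMeas_term {d : ℕ} (hd : 2 ≤ d) {α R : ℝ} (hα : 1 < α) (hR : 0 < R) (n k : ℕ) :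
    ∫ r, r ^ n * Real.exp (-R * r ^ α) * (r ^ α) ^ k / (Nat.factorial k : ℝ) ∂(radMeas d) =
      radCoef d α R n k / α := by
  have hα0 : 0 < α := by linarith
  rw [integral_radMeas]
  have h := integral_rpow_mul_exp_neg_mul_rpow (p := α) (q := ((d - 1 + n : ℕ) : ℝ) + α * k)
    (b := R) hα0 (by
      have : 0 ≤ ((d - 1 + n : ℕ) : ℝ) + α * k := by positivity
      linarith) hR
  have hd' : ((d - 1 + n : ℕ) : ℝ) = d - 1 + n := by
    rw [Nat.cast_add, Nat.cast_sub (by omega)]; simp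
  have hq : (((d - 1 + n : ℕ) : ℝ) + α * k + 1) / α = (k : ℝ) + ((n : ℝ) + d) / α := by
    rw [hd']; field_simp; ring
  have hq' : -(((d - 1 + n : ℕ) : ℝ) + α * k + 1) / α = -((k : ℝ) + ((n : ℝ) + d) / α) := by
    rw [← hq]; ring
  rw [hq, hq', Real.rpow_neg hR.le] at h
  calc _ = ∫ r in Set.Ioi 0, (r ^ (((d - 1 + n : ℕ) : ℝ) + α * k) * Real.exp (-R * r ^ α)) *
          ((Nat.factorial k : ℝ))⁻¹ := by
        refine setIntegral_congr_fun measurableSet_Ioi fun r hr => ?_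
        have hr' : 0 < r := hr
        simp only [smul_eq_mul]
        rw [Real.rpow_add hr', Real.rpow_natCast, Real.rpow_mul_natCast hr'.le, pow_add]
        ring
    _ = _ := by
        rw [integral_mul_const, h, radCoef]
        field_simp

/-- Expansion of the radial moments around `R`. -/
lemma hasSum_radMoment {d : ℕ} (hd : 2 ≤ d) {α R ρ : ℝ} (hα : 1 < α) (hρ : 0 ≤ ρ) (hρR : ρ < R)
    (n : ℕ) {w : ℂ} (hw : ‖w‖ ≤ ρ) :
    HasSum (fun k => ((radCoef d α R n k / α : ℝ) : ℂ) * w ^ k) (radMoment d α n (R - w)) := by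
  have hR : 0 < R := by linarith
  have hsum : ∀ r : ℝ, HasSum (fun k : ℕ => r ^ n * Real.exp (-R * r ^ α) *
      ((r ^ α) ^ k * ρ ^ k / (Nat.factorial k : ℝ))) (r ^ n * Real.exp (-(R - ρ) * r ^ α)) := by
    intro r
    have h1 := NormedSpace.expSeries_div_hasSum_exp (r ^ α * ρ)
    rw [← Real.exp_eq_exp_ℝ] at h1
    have h2 := h1.mul_left (r ^ n * Real.exp (-R * r ^ α))
    rw [mul_assoc, ← Real.exp_add] at h2
    refine hasSum_of_eq h2 (fun k => by rw [mul_pow]) (by ring_nf)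
  have key := hasSum_integral_of_dominated_convergence (μ := radMeas d)
    (F := fun (k : ℕ) r => ((r ^ n * Real.exp (-R * r ^ α) * (r ^ α) ^ k /
      (Nat.factorial k : ℝ) : ℝ) : ℂ) * w ^ k)
    (f := fun r => ((r ^ n : ℝ) : ℂ) * Complex.exp (-(((r ^ α : ℝ) : ℂ) * (R - w))))
    (fun k r => r ^ n * Real.exp (-R * r ^ α) * ((r ^ α) ^ k * ρ ^ k / (Nat.factorial k : ℝ)))
    (fun k => by fun_prop) ?_ (.of_forall fun r => (hsum r).summable) ?_
    (.of_forall fun r => ?_)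
  · simp_rw [integral_mul_const, integral_complex_ofReal, integral_radMeas_term hd hα hR] at key
    exact key
  · intro k
    filter_upwards [ae_radMeas_pos d] with r hr
    rw [norm_mul, Complex.norm_real, Real.norm_of_nonneg (by positivity), norm_pow]
    have : ‖w‖ ^ k ≤ ρ ^ k := by gcongr
    calc _ ≤ r ^ n * Real.exp (-R * r ^ α) * (r ^ α) ^ k / (Nat.factorial k : ℝ) * ρ ^ k := by
          gcongr
      _ = _ := by ring
  · simp_rw [fun r => (hsum r).tsum_eq]
    exact integrable_pow_exp_rpow d hα (by linarith) n
  · have h1 := NormedSpace.expSeries_div_hasSum_exp (((r ^ α : ℝ) : ℂ) * w)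
    rw [← Complex.exp_eq_exp_ℂ] at h1
    have h2 := h1.mul_left (((r ^ n * Real.exp (-R * r ^ α) : ℝ) : ℂ))
    refine hasSum_of_eq h2 (fun k => ?_) ?_
    · push_cast; rw [mul_pow]; ring
    · rw [Complex.ofReal_mul, Complex.ofReal_exp, mul_assoc, ← Complex.exp_add]
      push_cast; ring_nf

lemma hasSum_radMomentR {d : ℕ} (hd : 2 ≤ d) {α R ρ : ℝ} (hα : 1 < α) (hρ : 0 ≤ ρ) (hρR : ρ < R)
    (n : ℕ) : HasSum (fun k => radCoef d α R n k / α * ρ ^ k) (radMomentR d α n (R - ρ)) := by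
  have h := hasSum_radMoment (w := (ρ : ℂ)) hd hα hρ hρR n
    (by rw [Complex.norm_real, Real.norm_of_nonneg hρ])
  rw [← Complex.hasSum_ofReal]
  refine hasSum_of_eq h (fun k => by push_cast; rfl) ?_
  · rw [radMoment, radMomentR, ← integral_complex_ofReal]
    congr 1; ext r; push_cast; ring_nf

lemma norm_radMoment_le {d : ℕ} {α δ : ℝ} (hα : 1 < α) (hδ : 0 < δ) (n : ℕ) {V : ℂ}
    (hV : δ ≤ V.re) : ‖radMoment d α n V‖ ≤ radMomentR d α n δ := by
  refine norm_integral_le_of_norm_le (integrable_pow_exp_rpow d hα hδ n) ?_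
  filter_upwards [ae_radMeas_pos d] with r hr
  rw [norm_mul, Complex.norm_real, Real.norm_of_nonneg (by positivity)]
  gcongr
  exact norm_exp_neg_rpow_mul_le hr hV

lemma continuous_radMoment_comp {X : Type*} [TopologicalSpace X] [FirstCountableTopology X]
    {d : ℕ} {α δ : ℝ} (hα : 1 < α) (hδ : 0 < δ) (n : ℕ) {V : X → ℂ} (hVc : Continuous V)
    (hV : ∀ v, δ ≤ (V v).re) : Continuous fun v => radMoment d α n (V v) := by
  refine continuous_of_dominated (bound := fun r => r ^ n * Real.exp (-δ * r ^ α))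
    (fun v => by fun_prop) (fun v => ?_) (integrable_pow_exp_rpow d hα hδ n)
    (.of_forall fun r => by fun_prop)
  filter_upwards [ae_radMeas_pos d] with r hr
  rw [norm_mul, Complex.norm_real, Real.norm_of_nonneg (by positivity)]
  gcongr
  exact norm_exp_neg_rpow_mul_le hr (hV v)

lemma summable_radMomentR {d : ℕ} {α δ : ℝ} (hα : 1 < α) (hδ : 0 < δ) {B : ℝ} (hB : 0 ≤ B) :
    Summable fun n : ℕ => B ^ n / (Nat.factorial n : ℝ) * radMomentR d α n δ := by
  have hsum : ∀ r : ℝ, HasSum (fun n : ℕ => B ^ n / (Nat.factorial n : ℝ) *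
      (r ^ n * Real.exp (-δ * r ^ α))) (Real.exp (B * r) * Real.exp (-δ * r ^ α)) := by
    intro r
    have h1 := NormedSpace.expSeries_div_hasSum_exp (B * r)
    rw [← Real.exp_eq_exp_ℝ] at h1
    exact hasSum_of_eq (h1.mul_right (Real.exp (-δ * r ^ α)))
      (fun k => by rw [mul_pow]; ring) rfl
  have key := hasSum_integral_of_dominated_convergence (μ := radMeas d)
    (F := fun (n : ℕ) r => B ^ n / (Nat.factorial n : ℝ) * (r ^ n * Real.exp (-δ * r ^ α)))
    (f := fun r => Real.exp (B * r) * Real.exp (-δ * r ^ α))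
    (fun n r => B ^ n / (Nat.factorial n : ℝ) * (r ^ n * Real.exp (-δ * r ^ α)))
    (fun n => by fun_prop) ?_ (.of_forall fun r => (hsum r).summable) ?_ (.of_forall hsum)
  · simp_rw [integral_const_mul] at key
    exact key.summable
  · intro n
    filter_upwards [ae_radMeas_pos d] with r hr
    rw [Real.norm_of_nonneg (by positivity)]
  · simp_rw [fun r => (hsum r).tsum_eq]
    exact integrable_exp_mul_exp_rpow d hα B hδ

lemma hasSum_pow_radMoment {d : ℕ} {α δ : ℝ} (hα : 1 < α) (hδ : 0 < δ) (c : ℂ) {V : ℂ}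
    (hV : δ ≤ V.re) :
    HasSum (fun n : ℕ => c ^ n / (Nat.factorial n : ℂ) * radMoment d α n V)
      (∫ r, Complex.exp (c * r) * Complex.exp (-(((r ^ α : ℝ) : ℂ) * V)) ∂(radMeas d)) := by
  have hsum : ∀ r : ℝ, HasSum (fun n : ℕ => ‖c‖ ^ n / (Nat.factorial n : ℝ) *
      (r ^ n * Real.exp (-δ * r ^ α))) (Real.exp (‖c‖ * r) * Real.exp (-δ * r ^ α)) := by
    intro r
    have h1 := NormedSpace.expSeries_div_hasSum_exp (‖c‖ * r)
    rw [← Real.exp_eq_exp_ℝ] at h1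
    exact hasSum_of_eq (h1.mul_right (Real.exp (-δ * r ^ α)))
      (fun k => by rw [mul_pow]; ring) rfl
  have key := hasSum_integral_of_dominated_convergence (μ := radMeas d)
    (F := fun (n : ℕ) r => c ^ n / (Nat.factorial n : ℂ) *
      (((r ^ n : ℝ) : ℂ) * Complex.exp (-(((r ^ α : ℝ) : ℂ) * V))))
    (f := fun r => Complex.exp (c * r) * Complex.exp (-(((r ^ α : ℝ) : ℂ) * V)))
    (fun n r => ‖c‖ ^ n / (Nat.factorial n : ℝ) * (r ^ n * Real.exp (-δ * r ^ α)))
    (fun n => by fun_prop) ?_ (.of_forall fun r => (hsum r).summable) ?_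
    (.of_forall fun r => ?_)
  · simp_rw [integral_const_mul] at key
    exact key
  · intro n
    filter_upwards [ae_radMeas_pos d] with r hr
    rw [norm_mul, norm_mul, norm_div, norm_pow, Complex.norm_natCast, Complex.norm_real,
      Real.norm_of_nonneg (by positivity)]
    gcongr
    exact norm_exp_neg_rpow_mul_le hr hV
  · simp_rw [fun r => (hsum r).tsum_eq]
    exact integrable_exp_mul_exp_rpow d hα ‖c‖ hδ
  · have h1 := NormedSpace.expSeries_div_hasSum_exp (c * r)
    rw [← Complex.exp_eq_exp_ℂ] at h1
    exact hasSum_of_eq (h1.mul_right (Complex.exp (-(((r ^ α : ℝ) : ℂ) * V))))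
      (fun k => by push_cast; rw [mul_pow]; ring) rfl

lemma Vfun_re_ge {d : ℕ} {α : ℝ} {Λ : Measure (Sph d)} {R ρ : ℝ} {u : Sph d}
    (h : ‖(R : ℂ) - Vfun d α Λ u‖ ≤ ρ) : R - ρ ≤ (Vfun d α Λ u).re := by
  have h1 := (Complex.re_le_norm ((R : ℂ) - Vfun d α Λ u)).trans h
  rw [Complex.sub_re, Complex.ofReal_re] at h1
  linarith

lemma norm_integral_sph_le {d : ℕ} {f : Sph d → ℂ} {C : ℝ} (hf : ∀ v, ‖f v‖ ≤ C) :
    ‖∫ v, f v ∂(ωd d)‖ ≤ C * (ωd d).real Set.univ :=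
  norm_integral_le_of_norm_le_const (.of_forall hf)

/-- Termwise integration of the expansion of the radial moments around `R`. -/
lemma hasSum_integral_radMoment {d : ℕ} (hd : 2 ≤ d) {α R ρ : ℝ} (hα : 1 < α)
    (hρ : 0 ≤ ρ) (hρR : ρ < R) {V K : Sph d → ℂ} (hV : Continuous V)
    (hW : ∀ v, ‖(R : ℂ) - V v‖ ≤ ρ) (hK : Continuous K) {C : ℝ} (hKC : ∀ v, ‖K v‖ ≤ C)
    (n : ℕ) :
    HasSum (fun k => (radCoef d α R n k : ℂ) * ∫ v, K v * ((R : ℂ) - V v) ^ k ∂(ωd d))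
      (α * ∫ v, K v * radMoment d α n (V v) ∂(ωd d)) := by
  have hα0 : (α : ℂ) ≠ 0 := by exact_mod_cast (by linarith : α ≠ 0)
  have hC : 0 ≤ C := by
    obtain ⟨u⟩ := nonempty_sph hd
    exact (norm_nonneg _).trans (hKC u)
  have hR : 0 ≤ R := by linarith
  have hsum := (hasSum_radMomentR hd hα hρ hρR n).mul_left C
  have key := hasSum_integral_of_dominated_convergence (μ := ωd d)
    (F := fun (k : ℕ) v => K v * (((radCoef d α R n k / α : ℝ) : ℂ) * ((R : ℂ) - V v) ^ k))
    (f := fun v => K v * radMoment d α n (V v))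
    (fun k _ => C * (radCoef d α R n k / α * ρ ^ k)) (fun k => by fun_prop) (fun k => ?_)
    (.of_forall fun _ => hsum.summable) (integrable_const _) (.of_forall fun v => ?_)
  · refine hasSum_of_eq (key.mul_left (α : ℂ)) (fun k => ?_) rfl
    rw [← integral_const_mul, ← integral_const_mul]
    congr 1; ext v; push_cast; field_simp
  · refine .of_forall fun v => ?_
    have h0 : 0 ≤ radCoef d α R n k / α :=
      div_nonneg (radCoef_nonneg d hα hR n k) (by linarith)
    rw [norm_mul, norm_mul, norm_pow, Complex.norm_real, Real.norm_of_nonneg h0]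
    gcongr
    · exact hKC v
    · exact hW v
  · have := (hasSum_radMoment hd hα hρ hρR n (hW v)).mul_left (K v)
    rwa [sub_sub_cancel] at this

/-- A bound for the sum of the absolute values of the terms in `hasSum_integral_radMoment`. -/
lemma summable_norm_radCoef_integral {d : ℕ} (hd : 2 ≤ d) {α R ρ : ℝ} (hα : 1 < α)
    (hρ : 0 ≤ ρ) (hρR : ρ < R) {V K : Sph d → ℂ}
    (hW : ∀ v, ‖(R : ℂ) - V v‖ ≤ ρ) {C : ℝ} (hKC : ∀ v, ‖K v‖ ≤ C) (n : ℕ) :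
    Summable (fun k => ‖(radCoef d α R n k : ℂ) * ∫ v, K v * ((R : ℂ) - V v) ^ k ∂(ωd d)‖) ∧
      ∑' k, ‖(radCoef d α R n k : ℂ) * ∫ v, K v * ((R : ℂ) - V v) ^ k ∂(ωd d)‖ ≤
        α * (C * (ωd d).real Set.univ) * radMomentR d α n (R - ρ) := by
  have hC : 0 ≤ C := by
    obtain ⟨u⟩ := nonempty_sph hd
    exact (norm_nonneg _).trans (hKC u)
  have hR : 0 ≤ R := by linarith
  have hα0 : α ≠ 0 := by linarith
  have hsum := (hasSum_radMomentR hd hα hρ hρR n).mul_left (α * (C * (ωd d).real Set.univ))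
  have hle : ∀ k, ‖(radCoef d α R n k : ℂ) * ∫ v, K v * ((R : ℂ) - V v) ^ k ∂(ωd d)‖ ≤
      α * (C * (ωd d).real Set.univ) * (radCoef d α R n k / α * ρ ^ k) := by
    intro k
    rw [norm_mul, Complex.norm_real, Real.norm_of_nonneg (radCoef_nonneg d hα hR n k)]
    have h1 : ‖∫ v, K v * ((R : ℂ) - V v) ^ k ∂(ωd d)‖ ≤
        C * ρ ^ k * (ωd d).real Set.univ := by
      refine norm_integral_sph_le fun v => ?_
      rw [norm_mul, norm_pow]
      gcongr
      · exact hKC v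
      · exact hW v
    have h0 := radCoef_nonneg d hα hR n k
    calc _ ≤ radCoef d α R n k * (C * ρ ^ k * (ωd d).real Set.univ) := by gcongr
      _ = _ := by field_simp
  have hs := Summable.of_nonneg_of_le (fun k => norm_nonneg _) hle hsum.summable
  exact ⟨hs, (hs.tsum_le_tsum hle hsum.summable).trans_eq hsum.tsum_eq⟩

lemma continuous_exp_neg_charExp {d : ℕ} {α : ℝ} {Λ : Measure (Sph d)} {μ : Measure (Ed d)}
    [IsProbabilityMeasure μ] (hμ : IsStableChar d α Λ μ) :
    Continuous fun z => Complex.exp (-charExp d α Λ z) := by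
  rw [← funext (charFun_eq_exp hμ)]
  exact continuous_charFun

lemma charExp_polar {d : ℕ} {α : ℝ} (Λ : Measure (Sph d)) {r : ℝ} (hr : 0 < r) (u : Sph d) :
    charExp d α Λ (r • (u : Ed d)) = ((r ^ α : ℝ) : ℂ) * Vfun d α Λ u :=
  charExp_smul Λ hr _

lemma integrable_exp_neg_charExp {d : ℕ} (hd : 2 ≤ d) {α : ℝ} (hα : 1 < α) {Λ : Measure (Sph d)}
    {μ : Measure (Ed d)} [IsProbabilityMeasure μ] (hμ : IsStableChar d α Λ μ) {R ρ : ℝ}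
    (hρR : ρ < R) (hW : ∀ v, ‖(R : ℂ) - Vfun d α Λ v‖ ≤ ρ) :
    Integrable fun z => Complex.exp (-charExp d α Λ z) := by
  refine integrable_of_polar_bound hd (continuous_exp_neg_charExp hμ).aestronglyMeasurable
    (integrable_pow_exp_rpow d hα (sub_pos.2 hρR) 0) fun u r hr => ?_
  rw [charExp_polar Λ hr, pow_zero, one_mul]
  exact norm_exp_neg_rpow_mul_le hr (Vfun_re_ge (hW u))

/-- The degree `n` term of the Taylor expansion of the inverse Fourier integral along a ray. -/
def taylorTerm (d : ℕ) (α : ℝ) (Λ : Measure (Sph d)) (t : ℝ) (u : Sph d) (n : ℕ) : ℂ :=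
  (-(Complex.I * t)) ^ n / (Nat.factorial n : ℂ) *
    ∫ v, ((⟪(u : Ed d), (v : Ed d)⟫ ^ n : ℝ) : ℂ) * radMoment d α n (Vfun d α Λ v) ∂(ωd d)

lemma hasSum_taylorTerm {d : ℕ} (hd : 2 ≤ d) {α : ℝ} (hα : 1 < α) {Λ : Measure (Sph d)}
    [IsFiniteMeasure Λ] {μ : Measure (Ed d)} [IsProbabilityMeasure μ]
    (hμ : IsStableChar d α Λ μ) {R ρ : ℝ} (hρR : ρ < R)
    (hW : ∀ v, ‖(R : ℂ) - Vfun d α Λ v‖ ≤ ρ) {g : Ed d → ℝ} (hg : IsDensityOf d α Λ g)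
    (t : ℝ) (u : Sph d) :
    HasSum (fun n => ((((2 * Real.pi) ^ d)⁻¹ : ℝ) : ℂ) * taylorTerm d α Λ t u n)
      (g (t • (u : Ed d)) : ℂ) := by
  have hδ : 0 < R - ρ := sub_pos.2 hρR
  have hint := integrable_exp_neg_charExp hd hα hμ hρR hW
  have hint2 : Integrable fun z => Complex.exp (-(Complex.I * (⟪t • (u : Ed d), z⟫ : ℂ))) *
      Complex.exp (-charExp d α Λ z) := by
    refine hint.bdd_mul (c := 1) (by fun_prop) (.of_forall fun z => ?_)
    rw [← mul_neg, mul_comm, ← Complex.ofReal_neg, Complex.norm_exp_ofReal_mul_I]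
  rw [hg, integral_polar hd hint2]
  refine HasSum.mul_left _ ?_
  have hin : ∀ v : Sph d, ∫ r, Complex.exp (-(Complex.I *
      (⟪t • (u : Ed d), r • (v : Ed d)⟫ : ℂ))) * Complex.exp (-charExp d α Λ (r • (v : Ed d)))
        ∂(radMeas d) = ∫ r, Complex.exp (-(Complex.I * t * (⟪(u : Ed d), (v : Ed d)⟫ : ℂ)) * r) *
          Complex.exp (-(((r ^ α : ℝ) : ℂ) * Vfun d α Λ v)) ∂(radMeas d) := by
    intro v
    refine integral_congr_ae ?_
    filter_upwards [ae_radMeas_pos d] with r hr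
    rw [charExp_polar Λ hr, real_inner_smul_left, real_inner_smul_right]
    push_cast
    ring_nf
  simp_rw [hin]
  have hcV := continuous_Vfun hα Λ
  have hcQ : ∀ n, Continuous fun v => radMoment d α n (Vfun d α Λ v) := fun n =>
    continuous_radMoment_comp hα hδ n hcV fun v => Vfun_re_ge (hW v)
  have key := hasSum_integral_of_dominated_convergence (μ := ωd d)
    (F := fun (n : ℕ) v => (-(Complex.I * t * (⟪(u : Ed d), (v : Ed d)⟫ : ℂ))) ^ n /
      (Nat.factorial n : ℂ) * radMoment d α n (Vfun d α Λ v))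
    (f := fun v => ∫ r, Complex.exp (-(Complex.I * t * (⟪(u : Ed d), (v : Ed d)⟫ : ℂ)) * r) *
          Complex.exp (-(((r ^ α : ℝ) : ℂ) * Vfun d α Λ v)) ∂(radMeas d))
    (fun n _ => |t| ^ n / (Nat.factorial n : ℝ) * radMomentR d α n (R - ρ))
    (fun n => by have := hcQ n; fun_prop) (fun n => .of_forall fun v => ?_)
    (.of_forall fun _ => summable_radMomentR hα hδ (abs_nonneg t)) (integrable_const _)
    (.of_forall fun v => hasSum_pow_radMoment hα hδ _ (Vfun_re_ge (hW v)))
  · refine hasSum_of_eq key (fun n => ?_) rfl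
    rw [taylorTerm, ← integral_const_mul]
    congr 1; ext v
    rw [← neg_mul, mul_pow]
    push_cast
    ring
  · rw [norm_mul, norm_div, norm_pow, Complex.norm_natCast, norm_neg, norm_mul, norm_mul,
      Complex.norm_I, one_mul, Complex.norm_real, Complex.norm_real, Real.norm_eq_abs,
      Real.norm_eq_abs]
    have h1 := abs_inner_sph_le u v
    have h2 := norm_radMoment_le (d := d) hα hδ n (Vfun_re_ge (hW v))
    have h3 : |t| * |⟪(u : Ed d), (v : Ed d)⟫| ≤ |t| := mul_le_of_le_one_right (abs_nonneg t) h1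
    gcongr

lemma continuous_zonal (d j : ℕ) : Continuous (zonal d j) := by
  unfold zonal gegenbauerN gegenbauer
  split_ifs
  · exact continuous_const.mul (Polynomial.continuous _)
  · fun_prop

lemma sphereArea_pos {d : ℕ} (hd : 2 ≤ d) : 0 < sphereArea d := by
  have : 0 < Real.Gamma ((d : ℝ) / 2) := Real.Gamma_pos_of_pos (by positivity)
  unfold sphereArea
  positivity

lemma SHstar_eq (d : ℕ) (α : ℝ) (Λ : Measure (Sph d)) (R : ℝ) (j k : ℕ) (u : Sph d) :
    SHstar d α Λ R j k u = (-Complex.I) ^ j * (sphereArea d : ℂ)⁻¹ *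
      ∫ v, (zonal d j ⟪(u : Ed d), (v : Ed d)⟫ : ℂ) * ((R : ℂ) - Vfun d α Λ v) ^ k ∂(ωd d) := by
  have h : ∀ v : Sph d, (zonal d j ⟪(u : Ed d), (v : Ed d)⟫ : ℂ) * ((R : ℂ) - Vfun d α Λ v) ^ k =
      (cdim d j : ℂ) * ((gegenbauerN (((d : ℝ) - 2) / 2) j ⟪(u : Ed d), (v : Ed d)⟫ : ℂ) *
        ((R : ℂ) - Vfun d α Λ v) ^ k) := by
    intro v; rw [zonal]; push_cast; ring
  simp_rw [h]
  rw [integral_const_mul, SHstar, projC]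
  ring

lemma norm_zonal_inner_le {d : ℕ} (hd : 2 ≤ d) (j : ℕ) (u v : Sph d) :
    ‖(zonal d j ⟪(u : Ed d), (v : Ed d)⟫ : ℂ)‖ ≤ ((d : ℝ) + 2) ^ j := by
  rw [Complex.norm_real]
  exact abs_zonal_le hd j (abs_inner_sph_le u v)

lemma hasSum_radCoef_SHstar {d : ℕ} (hd : 2 ≤ d) {α R ρ : ℝ} (hα : 1 < α) {Λ : Measure (Sph d)}
    [IsFiniteMeasure Λ] (hρ : 0 ≤ ρ) (hρR : ρ < R) (hW : ∀ v, ‖(R : ℂ) - Vfun d α Λ v‖ ≤ ρ)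
    (n j : ℕ) (u : Sph d) :
    HasSum (fun k => (radCoef d α R n k : ℂ) * SHstar d α Λ R j k u)
      ((-Complex.I) ^ j * (sphereArea d : ℂ)⁻¹ * (α *
        ∫ v, (zonal d j ⟪(u : Ed d), (v : Ed d)⟫ : ℂ) *
          radMoment d α n (Vfun d α Λ v) ∂(ωd d))) := by
  have hz := continuous_zonal d j
  have h := hasSum_integral_radMoment hd hα hρ hρR (continuous_Vfun hα Λ) hW
    (K := fun v => (zonal d j ⟪(u : Ed d), (v : Ed d)⟫ : ℂ))
    (Complex.continuous_ofReal.comp (hz.comp (by fun_prop))) (norm_zonal_inner_le hd j u) n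
  refine hasSum_of_eq (h.mul_left ((-Complex.I) ^ j * (sphereArea d : ℂ)⁻¹)) (fun k => ?_) rfl
  rw [SHstar_eq]
  ring

lemma integrable_sph_of_continuous {d : ℕ} {f : Sph d → ℂ} (hf : Continuous f) :
    Integrable f (ωd d) :=
  hf.integrable_of_hasCompactSupport (HasCompactSupport.of_compactSpace f)

/-- The degree `n` term of the series for the density is the Taylor term of degree `n`. -/
lemma series_term_eq {d : ℕ} (hd : 2 ≤ d) {α R ρ : ℝ} (hα : 1 < α) {Λ : Measure (Sph d)}
    [IsFiniteMeasure Λ] (hρ : 0 ≤ ρ) (hρR : ρ < R) (hW : ∀ v, ‖(R : ℂ) - Vfun d α Λ v‖ ≤ ρ)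
    (n : ℕ) (t : ℝ) (u : Sph d) :
    (((t / 2) ^ n : ℝ) : ℂ) * ∑ m ∈ Finset.range (n / 2 + 1),
        (((-1 : ℝ) ^ m / ((Nat.factorial m : ℝ) *
          Real.Gamma ((n : ℝ) - m + (d : ℝ) / 2)) : ℝ) : ℂ) *
            ∑' k, (radCoef d α R n k : ℂ) * SHstar d α Λ R (n - 2 * m) k u =
      ((α / (2 * Real.pi ^ ((d : ℝ) / 2)) : ℝ) : ℂ) * taylorTerm d α Λ t u n := by
  have hδ : 0 < R - ρ := sub_pos.2 hρR
  have hG : 0 < Real.Gamma ((d : ℝ) / 2) := Real.Gamma_pos_of_pos (by positivity)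
  have hcQ : Continuous fun v => radMoment d α n (Vfun d α Λ v) :=
    continuous_radMoment_comp hα hδ n (continuous_Vfun hα Λ) fun v => Vfun_re_ge (hW v)
  have hterm : ∀ m ∈ Finset.range (n / 2 + 1),
      (((-1 : ℝ) ^ m / ((Nat.factorial m : ℝ) *
          Real.Gamma ((n : ℝ) - m + (d : ℝ) / 2)) : ℝ) : ℂ) *
            ∑' k, (radCoef d α R n k : ℂ) * SHstar d α Λ R (n - 2 * m) k u =
      (-Complex.I) ^ n * (sphereArea d : ℂ)⁻¹ * α *
        ∫ v, ((1 / ((Nat.factorial m : ℝ) * Real.Gamma ((n : ℝ) - m + (d : ℝ) / 2)) *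
          zonal d (n - 2 * m) ⟪(u : Ed d), (v : Ed d)⟫ : ℝ) : ℂ) *
            radMoment d α n (Vfun d α Λ v) ∂(ωd d) := by
    intro m hm
    have hm' : n = (n - 2 * m) + 2 * m := by
      have := Finset.mem_range.1 hm
      omega
    have hI : (-Complex.I) ^ n = (-1) ^ m * (-Complex.I) ^ (n - 2 * m) := by
      conv_lhs => rw [hm', pow_add, pow_mul]
      simp [mul_comm]
    rw [(hasSum_radCoef_SHstar hd hα hρ hρR hW n (n - 2 * m) u).tsum_eq, hI]
    have h1 : ∀ v : Sph d, ((1 / ((Nat.factorial m : ℝ) *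
        Real.Gamma ((n : ℝ) - m + (d : ℝ) / 2)) *
          zonal d (n - 2 * m) ⟪(u : Ed d), (v : Ed d)⟫ : ℝ) : ℂ) *
            radMoment d α n (Vfun d α Λ v) = ((1 / ((Nat.factorial m : ℝ) *
        Real.Gamma ((n : ℝ) - m + (d : ℝ) / 2)) : ℝ) : ℂ) * ((zonal d (n - 2 * m)
          ⟪(u : Ed d), (v : Ed d)⟫ : ℂ) * radMoment d α n (Vfun d α Λ v)) := by
      intro v; push_cast; ring
    simp_rw [h1]
    rw [integral_const_mul]
    generalize Real.Gamma ((n : ℝ) - m + (d : ℝ) / 2) = G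
    push_cast
    ring
  rw [Finset.sum_congr rfl hterm, ← Finset.mul_sum, ← integral_finsetSum]
  · have hpe : ∀ v : Sph d, ∑ m ∈ Finset.range (n / 2 + 1),
        ((1 / ((Nat.factorial m : ℝ) * Real.Gamma ((n : ℝ) - m + (d : ℝ) / 2)) *
          zonal d (n - 2 * m) ⟪(u : Ed d), (v : Ed d)⟫ : ℝ) : ℂ) *
            radMoment d α n (Vfun d α Λ v) =
        ((2 ^ n / (Real.Gamma ((d : ℝ) / 2) * (Nat.factorial n : ℝ)) : ℝ) : ℂ) *
          (((⟪(u : Ed d), (v : Ed d)⟫ ^ n : ℝ) : ℂ) * radMoment d α n (Vfun d α Λ v)) := by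
      intro v
      have h := pow_expansion hd n ⟪(u : Ed d), (v : Ed d)⟫
      rw [← Finset.sum_mul, ← Complex.ofReal_sum]
      generalize (∑ m ∈ Finset.range (n / 2 + 1), 1 / ((Nat.factorial m : ℝ) *
        Real.Gamma ((n : ℝ) - m + (d : ℝ) / 2)) *
          zonal d (n - 2 * m) ⟪(u : Ed d), (v : Ed d)⟫) = S at h ⊢
      have hS : S = 2 ^ n / (Real.Gamma ((d : ℝ) / 2) * (Nat.factorial n : ℝ)) *
          ⟪(u : Ed d), (v : Ed d)⟫ ^ n := by
        field_simp at h ⊢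
        linarith
      rw [hS]
      push_cast
      ring
    simp_rw [hpe]
    rw [integral_const_mul, taylorTerm, sphereArea, ← mul_neg, mul_comm Complex.I, mul_pow]
    generalize (∫ v, ((⟪(u : Ed d), (v : Ed d)⟫ ^ n : ℝ) : ℂ) *
      radMoment d α n (Vfun d α Λ v) ∂(ωd d)) = J
    have hG' : ((Real.Gamma ((d : ℝ) / 2) : ℝ) : ℂ) ≠ 0 := by exact_mod_cast hG.ne'
    generalize Real.Gamma ((d : ℝ) / 2) = G at hG' ⊢
    have hpi : ((Real.pi ^ ((d : ℝ) / 2) : ℝ) : ℂ) ≠ 0 := by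
      exact_mod_cast (Real.rpow_pos_of_pos Real.pi_pos _).ne'
    generalize Real.pi ^ ((d : ℝ) / 2) = P at hpi ⊢
    have hf : (Nat.factorial n : ℂ) ≠ 0 := by exact_mod_cast n.factorial_ne_zero
    push_cast
    rw [div_pow]
    field_simp
    ring
  · intro m _
    have hz := continuous_zonal d (n - 2 * m)
    refine integrable_sph_of_continuous (Continuous.mul ?_ hcQ)
    exact Complex.continuous_ofReal.comp (continuous_const.mul (hz.comp (by fun_prop)))

/-- The spherical harmonic series for the density. -/
lemma density_series {d : ℕ} (hd : 2 ≤ d) {α R ρ : ℝ} (hα : 1 < α) {Λ : Measure (Sph d)}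
    [IsFiniteMeasure Λ] {μ : Measure (Ed d)} [IsProbabilityMeasure μ]
    (hμ : IsStableChar d α Λ μ) (hρ : 0 ≤ ρ) (hρR : ρ < R)
    (hW : ∀ v, ‖(R : ℂ) - Vfun d α Λ v‖ ≤ ρ) {g : Ed d → ℝ} (hg : IsDensityOf d α Λ g)
    (t : ℝ) (u : Sph d) :
    (g (t • (u : Ed d)) : ℂ) =
      (((2 : ℝ) ^ (1 - (d : ℝ)) / (Real.pi ^ ((d : ℝ) / 2) * α) : ℝ) : ℂ) *
        ∑' n : ℕ, (((t / 2) ^ n : ℝ) : ℂ) * ∑ m ∈ Finset.range (n / 2 + 1),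
          (((-1 : ℝ) ^ m / ((Nat.factorial m : ℝ) *
            Real.Gamma ((n : ℝ) - m + (d : ℝ) / 2)) : ℝ) : ℂ) *
              ∑' k, (radCoef d α R n k : ℂ) * SHstar d α Λ R (n - 2 * m) k u := by
  simp_rw [series_term_eq hd hα hρ hρR hW _ t u]
  rw [tsum_mul_left, ← mul_assoc, ← Complex.ofReal_mul,
    ← (hasSum_taylorTerm hd hα hμ hρR hW hg t u).tsum_eq, tsum_mul_left]
  congr 2
  have h1 : (2 : ℝ) ^ (1 - (d : ℝ)) = 2 / 2 ^ d := by
    rw [Real.rpow_sub two_pos, Real.rpow_one, Real.rpow_natCast]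
  have h2 : Real.pi ^ d = Real.pi ^ ((d : ℝ) / 2) * Real.pi ^ ((d : ℝ) / 2) := by
    rw [← Real.rpow_add Real.pi_pos, add_halves, Real.rpow_natCast]
  have hpi : Real.pi ^ ((d : ℝ) / 2) ≠ 0 := (Real.rpow_pos_of_pos Real.pi_pos _).ne'
  have hα0 : α ≠ 0 := by linarith
  rw [h1, mul_pow, h2]
  field_simp

lemma factorial_mul_Gamma_le {b : ℝ} (hb : 1 ≤ b) (N : ℕ) :
    (Nat.factorial N : ℝ) * Real.Gamma b ≤ Real.Gamma (N + b) := by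
  induction N with
  | zero => simp
  | succ N ih =>
    have h : ((N + 1 : ℕ) : ℝ) + b = (N + b) + 1 := by push_cast; ring
    have hpos : (0 : ℝ) < N + b := by positivity
    rw [h, Real.Gamma_add_one hpos.ne', Nat.factorial_succ, Nat.cast_mul, mul_assoc]
    have hG : 0 < Real.Gamma b := Real.Gamma_pos_of_pos (by linarith)
    gcongr
    push_cast
    linarith

lemma sum_inv_factorial_Gamma_le {b : ℝ} (hb : 1 ≤ b) (n : ℕ) :
    ∑ m ∈ Finset.range (n / 2 + 1),
      1 / ((Nat.factorial m : ℝ) * Real.Gamma ((n : ℝ) - m + b)) ≤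
        2 ^ n / ((Nat.factorial n : ℝ) * Real.Gamma b) := by
  have hG : 0 < Real.Gamma b := Real.Gamma_pos_of_pos (by linarith)
  calc _ ≤ ∑ m ∈ Finset.range (n / 2 + 1),
        (n.choose m : ℝ) * (1 / ((Nat.factorial n : ℝ) * Real.Gamma b)) := by
        refine Finset.sum_le_sum fun m hm => ?_
        have hmn : m ≤ n := by
          have := Finset.mem_range.1 hm
          omega
        have h := factorial_mul_Gamma_le hb (n - m)
        rw [Nat.cast_sub hmn] at h
        have hc : (n.choose m : ℝ) * (Nat.factorial m) * (Nat.factorial (n - m)) =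
            Nat.factorial n := by exact_mod_cast Nat.choose_mul_factorial_mul_factorial hmn
        rw [← hc]
        have hch : (0 : ℝ) < n.choose m := by exact_mod_cast Nat.choose_pos hmn
        calc _ ≤ 1 / ((Nat.factorial m : ℝ) * ((Nat.factorial (n - m) : ℝ) * Real.Gamma b)) := by
              gcongr
          _ = _ := by field_simp
    _ ≤ ∑ m ∈ Finset.range (n + 1),
        (n.choose m : ℝ) * (1 / ((Nat.factorial n : ℝ) * Real.Gamma b)) := by
        refine Finset.sum_le_sum_of_subset_of_nonneg ?_ fun _ _ _ => by positivity
        exact Finset.range_subset_range.2 (by omega)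
    _ = _ := by
        rw [← Finset.sum_mul, ← Nat.cast_sum, Nat.sum_range_choose]
        push_cast
        ring

/-- The spherical harmonic series converges absolutely and uniformly on bounded sets. -/
lemma series_bound {d : ℕ} (hd : 2 ≤ d) {α R ρ : ℝ} (hα : 1 < α) {Λ : Measure (Sph d)}
    (hρ : 0 ≤ ρ) (hρR : ρ < R) (hW : ∀ v, ‖(R : ℂ) - Vfun d α Λ v‖ ≤ ρ) {M : ℝ} (hM : 0 < M) :
    ∃ c : ℕ → ℝ, Summable c ∧ ∀ (n : ℕ) (t : ℝ) (u : Sph d), 0 ≤ t → t ≤ M →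
      ∑ m ∈ Finset.range (n / 2 + 1), ∑' k : ℕ,
        ‖(((t / 2) ^ n : ℝ) : ℂ) * ((((-1 : ℝ) ^ m / ((Nat.factorial m : ℝ) *
          Real.Gamma ((n : ℝ) - m + (d : ℝ) / 2)) : ℝ) : ℂ) *
            ((radCoef d α R n k : ℂ) * SHstar d α Λ R (n - 2 * m) k u))‖ ≤ c n := by
  have hb : 1 ≤ (d : ℝ) / 2 := by
    have : (2 : ℝ) ≤ d := by exact_mod_cast hd
    linarith
  have hG : 0 < Real.Gamma ((d : ℝ) / 2) := Real.Gamma_pos_of_pos (by positivity)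
  have hA := sphereArea_pos hd
  set S : ℝ := (ωd d).real Set.univ with hS
  have hS0 : 0 ≤ S := measureReal_nonneg
  have hα0 : 0 ≤ α := by linarith
  refine ⟨fun n => (sphereArea d)⁻¹ * α * S / Real.Gamma ((d : ℝ) / 2) *
    ((M * ((d : ℝ) + 2)) ^ n / (Nat.factorial n : ℝ) * radMomentR d α n (R - ρ)),
    (summable_radMomentR hα (sub_pos.2 hρR) (by positivity)).mul_left _, ?_⟩
  intro n t u ht htM
  have hq := radMomentR_nonneg d α n (R - ρ)
  calc _ ≤ ∑ m ∈ Finset.range (n / 2 + 1), ((M / 2) ^ n * ((sphereArea d)⁻¹ *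
        (α * (((d : ℝ) + 2) ^ n * S) * radMomentR d α n (R - ρ)))) *
          (1 / ((Nat.factorial m : ℝ) * Real.Gamma ((n : ℝ) - m + (d : ℝ) / 2))) := by
        refine Finset.sum_le_sum fun m hm => ?_
        have hmn : m ≤ n := by
          have := Finset.mem_range.1 hm
          omega
        have hmn' : (m : ℝ) ≤ n := by exact_mod_cast hmn
        have hGm : 0 < Real.Gamma ((n : ℝ) - m + (d : ℝ) / 2) :=
          Real.Gamma_pos_of_pos (by linarith)
        have hk : ∀ k : ℕ, ‖(((t / 2) ^ n : ℝ) : ℂ) * ((((-1 : ℝ) ^ m / ((Nat.factorial m : ℝ) *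
          Real.Gamma ((n : ℝ) - m + (d : ℝ) / 2)) : ℝ) : ℂ) *
            ((radCoef d α R n k : ℂ) * SHstar d α Λ R (n - 2 * m) k u))‖ =
            (t / 2) ^ n * (1 / ((Nat.factorial m : ℝ) *
              Real.Gamma ((n : ℝ) - m + (d : ℝ) / 2))) * (sphereArea d)⁻¹ *
                ‖(radCoef d α R n k : ℂ) * ∫ v, (zonal d (n - 2 * m)
                  ⟪(u : Ed d), (v : Ed d)⟫ : ℂ) * ((R : ℂ) - Vfun d α Λ v) ^ k ∂(ωd d)‖ := by
          intro k
          rw [SHstar_eq]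
          simp only [norm_mul, Complex.norm_real, norm_div, norm_pow, norm_neg, norm_one, one_pow,
            Complex.norm_I, norm_inv, Real.norm_of_nonneg hA.le, Real.norm_of_nonneg hGm.le,
            Real.norm_of_nonneg ht, Real.norm_natCast, Real.norm_ofNat]
          ring
        simp_rw [hk]
        rw [tsum_mul_left]
        have h1 := (summable_norm_radCoef_integral hd hα hρ hρR hW
          (norm_zonal_inner_le hd (n - 2 * m) u) n).2
        have h2 : ((d : ℝ) + 2) ^ (n - 2 * m) ≤ ((d : ℝ) + 2) ^ n :=
          pow_le_pow_right₀ (by linarith [(Nat.cast_nonneg d : (0 : ℝ) ≤ d)]) (by omega)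
        calc _ ≤ (M / 2) ^ n * (1 / ((Nat.factorial m : ℝ) *
              Real.Gamma ((n : ℝ) - m + (d : ℝ) / 2))) * (sphereArea d)⁻¹ *
              (α * (((d : ℝ) + 2) ^ n * S) * radMomentR d α n (R - ρ)) := by
              refine mul_le_mul (by gcongr) (h1.trans (by gcongr)) (tsum_nonneg fun _ =>
                norm_nonneg _) (by positivity)
          _ = _ := by ring
    _ ≤ ((M / 2) ^ n * ((sphereArea d)⁻¹ *
        (α * (((d : ℝ) + 2) ^ n * S) * radMomentR d α n (R - ρ)))) *
          (2 ^ n / ((Nat.factorial n : ℝ) * Real.Gamma ((d : ℝ) / 2))) := by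
        rw [← Finset.mul_sum]
        gcongr
        exact sum_inv_factorial_Gamma_le hb n
    _ = _ := by
        simp only [mul_pow, div_pow]
        field_simp

lemma norm_exp_I_mul_inner {d : ℕ} (x z : Ed d) :
    ‖Complex.exp (-(Complex.I * (⟪x, z⟫ : ℂ)))‖ = 1 := by
  rw [← mul_neg, mul_comm, ← Complex.ofReal_neg, Complex.norm_exp_ofReal_mul_I]

lemma inverse_fourier_rescale {d : ℕ} (φ : Ed d → ℂ) (x : Ed d) :
    ∫ v, Complex.exp (((2 * π * ⟪x, v⟫ : ℝ) : ℂ) * Complex.I) * φ ((-(2 * π)) • v) =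
      (((2 * Real.pi) ^ d)⁻¹ : ℝ) *
        ∫ z, Complex.exp (-(Complex.I * (⟪x, z⟫ : ℂ))) * φ z := by
  have h := Measure.integral_comp_smul (volume : Measure (Ed d))
    (fun z => Complex.exp (-(Complex.I * (⟪x, z⟫ : ℂ))) * φ z) (-(2 * π))
  rw [finrank_euclideanSpace_fin, abs_inv, abs_pow, abs_neg, abs_of_pos (by positivity)] at h
  rw [Complex.real_smul] at h
  rw [← h]
  congr 1; ext v
  rw [real_inner_smul_right]
  push_cast
  ring_nf

/-- Testing a finite measure with integrable characteristic function against a smooth function. -/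
lemma integral_eq_of_integrable_charFun {d : ℕ} (μ : Measure (Ed d)) [IsFiniteMeasure μ]
    (hφ : Integrable (charFun μ)) {h : Ed d → ℝ} (hh : ContDiff ℝ (⊤ : ℕ∞) h)
    (hc : HasCompactSupport h) :
    ∫ x, (h x : ℂ) ∂μ = ∫ x, (h x : ℂ) * ((((2 * Real.pi) ^ d)⁻¹ : ℝ) *
        ∫ z, Complex.exp (-(Complex.I * (⟪x, z⟫ : ℂ))) * charFun μ z) := by
  have hcH : HasCompactSupport fun x => (h x : ℂ) :=
    hc.comp_left (g := fun t : ℝ => (t : ℂ)) Complex.ofReal_zero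
  have hcd : ContDiff ℝ (⊤ : ℕ∞) fun x => (h x : ℂ) := Complex.ofRealCLM.contDiff.comp hh
  set H : SchwartzMap (Ed d) ℂ := hcH.toSchwartzMap hcd with hHdef
  have hH : ∀ x, H x = (h x : ℂ) := fun x => rfl
  set ψ : SchwartzMap (Ed d) ℂ := 𝓕⁻ H with hψ
  have hHψ : ∀ x, H x = ∫ v, Complex.exp (((-2 * π * ⟪v, x⟫ : ℝ) : ℂ) * Complex.I) * ψ v := by
    intro x
    have h1 : H = 𝓕 ψ := (FourierTransform.fourier_fourierInv_eq H).symm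
    conv_lhs => rw [h1, SchwartzMap.fourier_coe, fourier_eq']
    rfl
  have hψH : ∀ v, ψ v = ∫ x, Complex.exp (((2 * π * ⟪x, v⟫ : ℝ) : ℂ) * Complex.I) * H x := by
    intro v
    rw [hψ, SchwartzMap.fourierInv_coe, fourierInv_eq']
    rfl
  have hψi : Integrable (ψ : Ed d → ℂ) := ψ.integrable
  have hHi : Integrable (H : Ed d → ℂ) := H.integrable
  have hφ2 : Integrable fun v => charFun μ ((-(2 * π)) • v) :=
    hφ.comp_smul (neg_ne_zero.2 (by positivity))
  simp_rw [← hH]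
  calc ∫ x, H x ∂μ
      = ∫ x, (∫ v, Complex.exp (((-2 * π * ⟪v, x⟫ : ℝ) : ℂ) * Complex.I) * ψ v) ∂μ :=
        integral_congr_ae (.of_forall hHψ)
    _ = ∫ v, ∫ x, Complex.exp (((-2 * π * ⟪v, x⟫ : ℝ) : ℂ) * Complex.I) * ψ v ∂μ := by
        refine integral_integral_swap ?_
        refine (hψi.comp_snd μ).bdd_mul (c := 1) ?_ (.of_forall fun p => ?_)
        · exact Continuous.aestronglyMeasurable (by fun_prop)
        · rw [Complex.norm_exp_ofReal_mul_I]
    _ = ∫ v, ψ v * charFun μ ((-(2 * π)) • v) := by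
        congr 1; ext v
        rw [integral_mul_const, mul_comm, charFun_apply]
        congr 2; ext x
        rw [real_inner_smul_right, real_inner_comm]
        ring_nf
    _ = ∫ v, ∫ x, Complex.exp (((2 * π * ⟪x, v⟫ : ℝ) : ℂ) * Complex.I) *
          (charFun μ ((-(2 * π)) • v) * H x) := by
        congr 1; ext v
        rw [hψH v, ← integral_mul_const]
        congr 1; ext x; ring
    _ = ∫ x, ∫ v, Complex.exp (((2 * π * ⟪x, v⟫ : ℝ) : ℂ) * Complex.I) *
          (charFun μ ((-(2 * π)) • v) * H x) := by
        refine integral_integral_swap ?_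
        refine (hφ2.mul_prod hHi).bdd_mul (c := 1) ?_ (.of_forall fun p => ?_)
        · exact Continuous.aestronglyMeasurable (by fun_prop)
        · rw [Complex.norm_exp_ofReal_mul_I]
    _ = _ := by
        congr 1; ext x
        rw [← inverse_fourier_rescale, ← integral_const_mul]
        congr 1; ext v; ring

lemma eq_withDensity_of_integral_eq {d : ℕ} (μ : Measure (Ed d)) [IsFiniteMeasure μ]
    {g : Ed d → ℝ} (hg : Continuous g) {C : ℝ} (hgC : ∀ x, |g x| ≤ C)
    (h : ∀ f : Ed d → ℝ, ContDiff ℝ (⊤ : ℕ∞) f → HasCompactSupport f →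
      ∫ x, f x ∂μ = ∫ x, f x * g x) :
    μ = volume.withDensity (fun x => ENNReal.ofReal (g x)) ∧ ∀ᵐ x, 0 ≤ g x := by
  set ν : Measure (Ed d) := μ + volume with hν
  have : IsLocallyFiniteMeasure ν := by
    refine ⟨fun x => ?_⟩
    obtain ⟨s, hs, hs'⟩ := (volume : Measure (Ed d)).finiteAt_nhds x
    exact ⟨s, hs, by rw [hν, Measure.add_apply]; exact ENNReal.add_lt_top.2 ⟨measure_lt_top _ _, hs'⟩⟩
  have : SigmaFinite ν := by rw [hν]; infer_instance
  have hμν : μ ≪ ν := Measure.AbsolutelyContinuous.rfl.add_right volume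
  have hvν : (volume : Measure (Ed d)) ≪ ν := by
    rw [hν, add_comm]; exact Measure.AbsolutelyContinuous.rfl.add_right μ
  have hle : (volume : Measure (Ed d)) ≤ ν := Measure.le_add_left le_rfl
  have hle1 := Measure.rnDeriv_le_one_of_le hle
  have hf1 : LocallyIntegrable (fun x => (μ.rnDeriv ν x).toReal) ν :=
    Measure.integrable_toReal_rnDeriv.locallyIntegrable
  have hf2 : LocallyIntegrable (fun x => g x * ((volume : Measure (Ed d)).rnDeriv ν x).toReal) ν := by
    refine (locallyIntegrable_const C).mono ?_ ?_
    · have := Measure.measurable_rnDeriv (volume : Measure (Ed d)) ν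
      exact (hg.measurable.mul this.ennreal_toReal).aestronglyMeasurable
    · filter_upwards [hle1] with x hx
      have h1 : ((volume : Measure (Ed d)).rnDeriv ν x).toReal ≤ 1 := by
        refine ENNReal.toReal_le_of_le_ofReal zero_le_one ?_
        simpa using hx
      rw [norm_mul, Real.norm_eq_abs, Real.norm_of_nonneg ENNReal.toReal_nonneg]
      calc _ ≤ C * 1 := mul_le_mul (hgC x) h1 ENNReal.toReal_nonneg ((abs_nonneg _).trans (hgC x))
        _ ≤ _ := by rw [mul_one]; exact le_abs_self C
  have hae := ae_eq_of_integral_contDiff_smul_eq hf1 hf2 fun f hf hfc => by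
    have h1 := integral_rnDeriv_smul hμν (f := f)
    have h2 := integral_rnDeriv_smul hvν (f := fun x => f x * g x)
    simp only [smul_eq_mul] at h1 h2 ⊢
    calc _ = ∫ x, f x ∂μ := by rw [← h1]; congr 1; ext x; ring
      _ = _ := by rw [h f hf hfc, ← h2]; congr 1; ext x; ring
  constructor
  · have hmeas : Measurable fun x => ENNReal.ofReal (g x) := hg.measurable.ennreal_ofReal
    calc μ = ν.withDensity (μ.rnDeriv ν) := (Measure.withDensity_rnDeriv_eq μ ν hμν).symm
      _ = ν.withDensity ((volume : Measure (Ed d)).rnDeriv ν * fun x => ENNReal.ofReal (g x)) := by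
        refine withDensity_congr_ae ?_
        filter_upwards [hae, μ.rnDeriv_ne_top ν, (volume : Measure (Ed d)).rnDeriv_ne_top ν]
          with x hx hx1 hx2
        rw [← ENNReal.ofReal_toReal hx1, hx, ENNReal.ofReal_mul' ENNReal.toReal_nonneg,
          ENNReal.ofReal_toReal hx2, mul_comm]
        rfl
      _ = _ := by
        rw [withDensity_mul _ (Measure.measurable_rnDeriv _ _) hmeas,
          Measure.withDensity_rnDeriv_eq _ _ hvν]
  · filter_upwards [hvν.ae_le hae, Measure.rnDeriv_pos hvν,
      hvν.ae_le ((volume : Measure (Ed d)).rnDeriv_ne_top ν)] with x hx hx1 hx2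
    have h3 : 0 < ((volume : Measure (Ed d)).rnDeriv ν x).toReal := ENNReal.toReal_pos hx1.ne' hx2
    refine nonneg_of_mul_nonneg_left ?_ h3
    rw [← hx]
    exact ENNReal.toReal_nonneg

lemma continuous_density {d : ℕ} {α : ℝ} {Λ : Measure (Sph d)}
    (hφ : Integrable fun z => Complex.exp (-charExp d α Λ z)) {g : Ed d → ℝ}
    (hg : IsDensityOf d α Λ g) : Continuous g := by
  have hc : Continuous fun x => (g x : ℂ) := by
    rw [funext hg]
    refine continuous_const.mul (continuous_of_dominated (fun x => ?_) (fun x => ?_) hφ.norm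
      (.of_forall fun z => by fun_prop))
    · exact Continuous.aestronglyMeasurable (by fun_prop) |>.mul hφ.aestronglyMeasurable
    · exact .of_forall fun z => by rw [norm_mul, norm_exp_I_mul_inner, one_mul]
  exact (Complex.continuous_re.comp hc)

lemma exists_abs_density_le {d : ℕ} {α : ℝ} {Λ : Measure (Sph d)} {g : Ed d → ℝ}
    (hg : IsDensityOf d α Λ g) : ∃ C, ∀ x, |g x| ≤ C := by
  refine ⟨((2 * Real.pi) ^ d)⁻¹ * ∫ z, ‖Complex.exp (-charExp d α Λ z)‖, fun x => ?_⟩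
  rw [← Real.norm_eq_abs, ← Complex.norm_real, hg, norm_mul, Complex.norm_real,
    Real.norm_of_nonneg (by positivity)]
  gcongr
  refine (norm_integral_le_integral_norm _).trans_eq ?_
  congr 1; ext z
  rw [norm_mul, norm_exp_I_mul_inner, one_mul]

/-- The inverse Fourier integral is the density of the stable distribution. -/
lemma eq_withDensity_density {d : ℕ} {α : ℝ} {Λ : Measure (Sph d)}
    {μ : Measure (Ed d)} [IsProbabilityMeasure μ] (hμ : IsStableChar d α Λ μ)
    (hφ : Integrable fun z => Complex.exp (-charExp d α Λ z)) {g : Ed d → ℝ}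
    (hg : IsDensityOf d α Λ g) :
    μ = volume.withDensity (fun x => ENNReal.ofReal (g x)) ∧ ∀ᵐ x, 0 ≤ g x := by
  obtain ⟨C, hC⟩ := exists_abs_density_le hg
  refine eq_withDensity_of_integral_eq μ (continuous_density hφ hg) hC fun f hf hfc => ?_
  have hcf := funext (charFun_eq_exp hμ)
  have key := integral_eq_of_integrable_charFun μ (by rwa [hcf]) hf hfc
  rw [hcf] at key
  simp_rw [← hg _, ← Complex.ofReal_mul, integral_complex_ofReal] at key
  exact_mod_cast key

lemma integrable_density {d : ℕ} {α : ℝ} {Λ : Measure (Sph d)}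
    {μ : Measure (Ed d)} [IsProbabilityMeasure μ] (hμ : IsStableChar d α Λ μ)
    (hφ : Integrable fun z => Complex.exp (-charExp d α Λ z)) {g : Ed d → ℝ}
    (hg : IsDensityOf d α Λ g) : Integrable g := by
  obtain ⟨h1, h2⟩ := eq_withDensity_density hμ hφ hg
  refine ⟨(continuous_density hφ hg).aestronglyMeasurable, ?_⟩
  rw [hasFiniteIntegral_iff_ofReal h2]
  have h3 := congrArg (fun m : Measure (Ed d) => m Set.univ) h1
  simp only [measure_univ, withDensity_apply _ MeasurableSet.univ, Measure.restrict_univ] at h3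
  rw [← h3]
  exact ENNReal.one_lt_top

lemma integral_odd_pow_mul_gaussian {n : ℕ} (hn : Odd n) :
    ∫ t : ℝ, t ^ n * Real.exp (-t ^ 2) = 0 := by
  have h := integral_neg_eq_self (fun t : ℝ => t ^ n * Real.exp (-t ^ 2)) volume
  simp only [hn.neg_pow, neg_mul, even_two.neg_pow, integral_neg] at h
  linarith

lemma integral_even_pow_mul_gaussian (m : ℕ) :
    ∫ t : ℝ, t ^ (2 * m) * Real.exp (-t ^ 2) = Real.Gamma (m + 1 / 2) := by
  have h := integral_comp_abs (f := fun t : ℝ => t ^ (2 * m) * Real.exp (-t ^ 2))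
  simp only [sq_abs, (even_two_mul m).pow_abs] at h
  rw [h]
  have h2 := integral_rpow_mul_exp_neg_rpow (p := 2) (q := ((2 * m : ℕ) : ℝ)) two_pos
    (by have : (0 : ℝ) ≤ ((2 * m : ℕ) : ℝ) := by positivity
        linarith)
  simp only [Real.rpow_natCast, Real.rpow_two] at h2
  rw [h2]
  push_cast
  ring_nf

lemma integral_inner_pow_mul_gaussian {d : ℕ} (hd : 2 ≤ d) (v : Sph d) (n : ℕ) :
    ∫ x : Ed d, ⟪x, (v : Ed d)⟫ ^ n * Real.exp (-‖x‖ ^ 2) =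
      (∫ t : ℝ, t ^ n * Real.exp (-t ^ 2)) * √Real.pi ^ (d - 1) := by
  obtain ⟨e, rfl⟩ : ∃ e, d = e + 1 := ⟨d - 1, by omega⟩
  have hv : Orthonormal ℝ (({0} : Set (Fin (e + 1))).domRestrict fun _ => (v : Ed (e + 1))) := by
    refine ⟨fun _ => norm_sph v, fun i j hij => (hij ?_).elim⟩
    exact Subtype.ext (i.2.trans j.2.symm)
  obtain ⟨b, hb⟩ := hv.exists_orthonormalBasis_extension_of_card_eq (by simp)
  have hb0 : b 0 = v := hb 0 rfl
  have h1 := b.measurePreserving_repr_symm.integral_comp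
    b.repr.symm.toHomeomorph.measurableEmbedding
    (fun x : Ed (e + 1) => ⟪x, (v : Ed (e + 1))⟫ ^ n * Real.exp (-‖x‖ ^ 2))
  rw [← h1]
  have h2 := (PiLp.volume_preserving_toLp (Fin (e + 1))).integral_comp
    (MeasurableEquiv.toLp 2 _).measurableEmbedding
    (fun y => ⟪b.repr.symm y, (v : Ed (e + 1))⟫ ^ n * Real.exp (-‖b.repr.symm y‖ ^ 2))
  rw [← h2]
  have h3 : ∀ y : Fin (e + 1) → ℝ, ⟪b.repr.symm (WithLp.toLp 2 y), (v : Ed (e + 1))⟫ ^ n *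
      Real.exp (-‖b.repr.symm (WithLp.toLp 2 y)‖ ^ 2) =
      ∏ i, (if i = 0 then y i ^ n else 1) * Real.exp (-y i ^ 2) := by
    intro y
    rw [Finset.prod_mul_distrib, ← Real.exp_sum, LinearIsometryEquiv.norm_map,
      EuclideanSpace.norm_sq_eq, ← hb0, real_inner_comm, ← b.repr_apply_apply,
      LinearIsometryEquiv.apply_symm_apply]
    simp
  simp_rw [h3]
  rw [integral_fintype_prod_volume_eq_prod
    (fun i t => (if i = 0 then t ^ n else 1) * Real.exp (-t ^ 2)), Fin.prod_univ_succ]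
  have h4 := integral_gaussian 1
  simp only [neg_mul, one_mul, div_one] at h4
  simp [h4]

/-- Integrals of powers of a linear form over the sphere, in terms of Gaussian moments. -/
lemma integral_inner_pow_sph_mul {d : ℕ} (hd : 2 ≤ d) (v : Sph d) (n : ℕ) :
    (∫ u : Sph d, ⟪(u : Ed d), (v : Ed d)⟫ ^ n ∂(ωd d)) * (Real.Gamma (((n : ℝ) + d) / 2) / 2) =
      (∫ t : ℝ, t ^ n * Real.exp (-t ^ 2)) * √Real.pi ^ (d - 1) := by
  have hpol : ∀ (u : Sph d) (r : ℝ), ⟪r • (u : Ed d), (v : Ed d)⟫ ^ n *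
      Real.exp (-‖r • (u : Ed d)‖ ^ 2) =
      ⟪(u : Ed d), (v : Ed d)⟫ ^ n * (r ^ n * Real.exp (-1 * r ^ (2 : ℝ))) := by
    intro u r
    rw [real_inner_smul_left, mul_pow, norm_smul, norm_sph, mul_one, Real.norm_eq_abs, sq_abs,
      Real.rpow_two]
    ring_nf
  have hint : Integrable fun x : Ed d => ⟪x, (v : Ed d)⟫ ^ n * Real.exp (-‖x‖ ^ 2) := by
    refine integrable_of_polar_bound hd (Continuous.aestronglyMeasurable (by fun_prop))
      (integrable_pow_exp_rpow d one_lt_two one_pos n) fun u r hr => ?_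
    rw [hpol, norm_mul, norm_pow, Real.norm_of_nonneg (by positivity : 0 ≤ r ^ n * _)]
    refine mul_le_of_le_one_left (by positivity) ?_
    exact pow_le_one₀ (norm_nonneg _) (abs_inner_sph_le u v)
  rw [← integral_inner_pow_mul_gaussian hd, integral_polar hd hint]
  simp_rw [hpol, integral_const_mul]
  rw [integral_mul_const]
  congr 1
  have h := integral_radMeas_term hd one_lt_two one_pos n 0
  simp only [radCoef, pow_zero, mul_one, Nat.factorial_zero, Nat.cast_one, div_one, Nat.cast_zero,
    zero_add, Real.one_rpow] at h
  exact h.symm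

lemma integral_inner_odd_pow_sph {d : ℕ} (hd : 2 ≤ d) (v : Sph d) {n : ℕ} (hn : Odd n) :
    ∫ u : Sph d, ⟪(u : Ed d), (v : Ed d)⟫ ^ n ∂(ωd d) = 0 := by
  have h := integral_inner_pow_sph_mul hd v n
  rw [integral_odd_pow_mul_gaussian hn, zero_mul] at h
  refine (mul_eq_zero.1 h).resolve_right ?_
  have : 0 < Real.Gamma (((n : ℝ) + d) / 2) := Real.Gamma_pos_of_pos (by positivity)
  positivity

/-- `∫ ⟨u, v⟩ ^ (2m) ω(du)`, divided by `(2m)!`. -/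
lemma integral_inner_even_pow_sph {d : ℕ} (hd : 2 ≤ d) (v : Sph d) (m : ℕ) :
    (∫ u : Sph d, ⟪(u : Ed d), (v : Ed d)⟫ ^ (2 * m) ∂(ωd d)) / (Nat.factorial (2 * m) : ℝ) =
      2 * Real.pi ^ ((d : ℝ) / 2) /
        (4 ^ m * ((Nat.factorial m : ℝ) * Real.Gamma ((m : ℝ) + (d : ℝ) / 2))) := by
  have h := integral_inner_pow_sph_mul hd v (2 * m)
  rw [integral_even_pow_mul_gaussian] at h
  have hG : 0 < Real.Gamma ((m : ℝ) + (d : ℝ) / 2) := Real.Gamma_pos_of_pos (by positivity)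
  have h1 : (((2 * m : ℕ) : ℝ) + d) / 2 = (m : ℝ) + (d : ℝ) / 2 := by push_cast; ring
  have hl := Real.Gamma_mul_Gamma_add_half ((m : ℝ) + 1 / 2)
  have h2 : (m : ℝ) + 1 / 2 + 1 / 2 = m + 1 := by ring
  have h3 : 2 * ((m : ℝ) + 1 / 2) = ((2 * m : ℕ) : ℝ) + 1 := by push_cast; ring
  have h4 : (2 : ℝ) ^ (1 - (((2 * m : ℕ) : ℝ) + 1)) = (4 ^ m)⁻¹ := by
    rw [sub_add_cancel_right, Real.rpow_neg two_pos.le, Real.rpow_natCast, pow_mul]; norm_num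
  rw [h2, Real.Gamma_nat_eq_factorial, h3, Real.Gamma_nat_eq_factorial, h4] at hl
  have h5 : √Real.pi * √Real.pi ^ (d - 1) = Real.pi ^ ((d : ℝ) / 2) := by
    rw [mul_pow_sub_one (by omega), Real.sqrt_eq_rpow, ← Real.rpow_natCast,
      ← Real.rpow_mul Real.pi_pos.le]
    ring_nf
  rw [h1] at h
  have hm : (Nat.factorial m : ℝ) ≠ 0 := by positivity
  rw [div_eq_div_iff (by positivity) (by positivity), ← h5]
  have h6 : (4 : ℝ) ^ m * (4 ^ m)⁻¹ = 1 := mul_inv_cancel₀ (by positivity)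
  set I := ∫ u : Sph d, ⟪(u : Ed d), (v : Ed d)⟫ ^ (2 * m) ∂(ωd d)
  calc _ = 2 * 4 ^ m * (Nat.factorial m : ℝ) * (I * (Real.Gamma ((m : ℝ) + (d : ℝ) / 2) / 2)) := by
        ring
    _ = 2 * 4 ^ m * (Real.Gamma (m + 1 / 2) * (Nat.factorial m : ℝ)) * √Real.pi ^ (d - 1) := by
        rw [h]; ring
    _ = 2 * (4 ^ m * (4 ^ m)⁻¹) * (√Real.pi * √Real.pi ^ (d - 1)) *
          (Nat.factorial (2 * m) : ℝ) := by rw [hl]; ring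
    _ = _ := by rw [h6]; ring

lemma continuous_taylorTerm_integrand {d : ℕ} {α R ρ : ℝ} (hα : 1 < α) {Λ : Measure (Sph d)}
    [IsFiniteMeasure Λ] (hρR : ρ < R) (hW : ∀ v, ‖(R : ℂ) - Vfun d α Λ v‖ ≤ ρ) (n : ℕ) :
    Continuous fun p : Sph d × Sph d => ((⟪(p.1 : Ed d), (p.2 : Ed d)⟫ ^ n : ℝ) : ℂ) *
      radMoment d α n (Vfun d α Λ p.2) := by
  have hQ := continuous_radMoment_comp (d := d) hα (sub_pos.2 hρR) n (continuous_Vfun hα Λ)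
    fun v => Vfun_re_ge (hW v)
  have := hQ.comp (continuous_snd (X := Sph d) (Y := Sph d))
  exact Continuous.mul (by fun_prop) this

lemma norm_taylorTerm_integrand_le {d : ℕ} {α R ρ : ℝ} (hα : 1 < α) {Λ : Measure (Sph d)}
    (hρR : ρ < R) (hW : ∀ v, ‖(R : ℂ) - Vfun d α Λ v‖ ≤ ρ) (n : ℕ) (u v : Sph d) :
    ‖((⟪(u : Ed d), (v : Ed d)⟫ ^ n : ℝ) : ℂ) * radMoment d α n (Vfun d α Λ v)‖ ≤
      radMomentR d α n (R - ρ) := by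
  have h1 : ‖((⟪(u : Ed d), (v : Ed d)⟫ ^ n : ℝ) : ℂ)‖ ≤ 1 := by
    rw [Complex.norm_real, norm_pow]
    exact pow_le_one₀ (norm_nonneg _) (abs_inner_sph_le u v)
  have h2 := norm_radMoment_le (d := d) hα (sub_pos.2 hρR) n (Vfun_re_ge (hW v))
  rw [norm_mul]
  exact (mul_le_of_le_one_left (norm_nonneg _) h1).trans h2

lemma norm_taylorTerm_le {d : ℕ} {α R ρ : ℝ} (hα : 1 < α) {Λ : Measure (Sph d)}
    (hρR : ρ < R) (hW : ∀ v, ‖(R : ℂ) - Vfun d α Λ v‖ ≤ ρ) (t : ℝ) (u : Sph d) (n : ℕ) :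
    ‖taylorTerm d α Λ t u n‖ ≤ |t| ^ n / (Nat.factorial n : ℝ) * radMomentR d α n (R - ρ) *
      (ωd d).real Set.univ := by
  rw [taylorTerm, norm_mul, norm_div, norm_pow, norm_neg, norm_mul, Complex.norm_I, one_mul,
    Complex.norm_real, Real.norm_eq_abs, Complex.norm_natCast, mul_assoc]
  gcongr
  exact norm_integral_sph_le fun v => norm_taylorTerm_integrand_le hα hρR hW n u v

lemma continuous_taylorTerm {d : ℕ} {α R ρ : ℝ} (hα : 1 < α) {Λ : Measure (Sph d)}
    [IsFiniteMeasure Λ] (hρR : ρ < R) (hW : ∀ v, ‖(R : ℂ) - Vfun d α Λ v‖ ≤ ρ) (t : ℝ) (n : ℕ) :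
    Continuous fun u => taylorTerm d α Λ t u n := by
  have hc := continuous_taylorTerm_integrand hα hρR hW n
  refine continuous_const.mul (continuous_of_dominated
    (bound := fun _ => radMomentR d α n (R - ρ)) (fun u => ?_) (fun u => .of_forall fun v => ?_)
    (integrable_const _) (.of_forall fun v => ?_))
  · exact (hc.comp (Continuous.prodMk_right u)).aestronglyMeasurable
  · exact norm_taylorTerm_integrand_le hα hρR hW n u v
  · have h1 : Continuous fun u : Sph d => ((⟪(u : Ed d), (v : Ed d)⟫ ^ n : ℝ) : ℂ) := by fun_prop
    exact h1.mul continuous_const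

lemma integral_taylorTerm {d : ℕ} {α R ρ : ℝ} (hα : 1 < α) {Λ : Measure (Sph d)}
    [IsFiniteMeasure Λ] (hρR : ρ < R) (hW : ∀ v, ‖(R : ℂ) - Vfun d α Λ v‖ ≤ ρ) (t : ℝ) (n : ℕ) :
    ∫ u, taylorTerm d α Λ t u n ∂(ωd d) = (-(Complex.I * t)) ^ n / (Nat.factorial n : ℂ) *
      ∫ v, ((∫ u : Sph d, ⟪(u : Ed d), (v : Ed d)⟫ ^ n ∂(ωd d) : ℝ) : ℂ) *
        radMoment d α n (Vfun d α Λ v) ∂(ωd d) := by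
  have hc := continuous_taylorTerm_integrand hα hρR hW n
  simp only [taylorTerm]
  have hi : Integrable (fun p : Sph d × Sph d => ((⟪(p.1 : Ed d), (p.2 : Ed d)⟫ ^ n : ℝ) : ℂ) *
      radMoment d α n (Vfun d α Λ p.2)) ((ωd d).prod (ωd d)) :=
    .of_bound hc.aestronglyMeasurable (radMomentR d α n (R - ρ))
      (.of_forall fun p => norm_taylorTerm_integrand_le hα hρR hW n p.1 p.2)
  have hsw := integral_integral_swap (μ := ωd d) (ν := ωd d)
    (f := fun u v : Sph d => ((⟪(u : Ed d), (v : Ed d)⟫ ^ n : ℝ) : ℂ) *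
      radMoment d α n (Vfun d α Λ v)) hi
  rw [integral_const_mul, hsw]
  congr 2; ext v
  rw [integral_mul_const, integral_complex_ofReal]

lemma integral_taylorTerm_odd {d : ℕ} (hd : 2 ≤ d) {α R ρ : ℝ} (hα : 1 < α) {Λ : Measure (Sph d)}
    [IsFiniteMeasure Λ] (hρR : ρ < R) (hW : ∀ v, ‖(R : ℂ) - Vfun d α Λ v‖ ≤ ρ) (t : ℝ) {n : ℕ}
    (hn : Odd n) : ∫ u, taylorTerm d α Λ t u n ∂(ωd d) = 0 := by
  simp [integral_taylorTerm hα hρR hW, integral_inner_odd_pow_sph hd _ hn]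

lemma integral_taylorTerm_even {d : ℕ} (hd : 2 ≤ d) {α R ρ : ℝ} (hα : 1 < α)
    {Λ : Measure (Sph d)} [IsFiniteMeasure Λ] (hρ : 0 ≤ ρ) (hρR : ρ < R)
    (hW : ∀ v, ‖(R : ℂ) - Vfun d α Λ v‖ ≤ ρ) (t : ℝ) (m : ℕ) :
    ∫ u, taylorTerm d α Λ t u (2 * m) ∂(ωd d) =
      ((2 * Real.pi ^ ((d : ℝ) / 2) / α : ℝ) : ℂ) *
      ((((-(t ^ 2) / 4) ^ m / ((Nat.factorial m : ℝ) *
            Real.Gamma ((m : ℝ) + (d : ℝ) / 2)) : ℝ) : ℂ) *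
        ∑' k, (radCoef d α R (2 * m) k : ℂ) *
          ∫ u, ((R : ℂ) - Vfun d α Λ u) ^ k ∂(ωd d)) := by
  have hs := hasSum_integral_radMoment hd hα hρ hρR (continuous_Vfun hα Λ) hW
    (K := fun _ => 1) continuous_const (C := 1) (by simp) (2 * m)
  simp only [one_mul] at hs
  have hα0 : (α : ℂ) ≠ 0 := by exact_mod_cast (by linarith : α ≠ 0)
  have hf : (Nat.factorial (2 * m) : ℝ) ≠ 0 := by positivity
  have hmom : ∀ v : Sph d, ∫ u : Sph d, ⟪(u : Ed d), (v : Ed d)⟫ ^ (2 * m) ∂(ωd d) = _ :=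
    fun v => (div_eq_iff hf).1 (integral_inner_even_pow_sph hd v m)
  have hI : (-(Complex.I * t)) ^ (2 * m) = (((-(t ^ 2)) ^ m : ℝ) : ℂ) := by
    rw [pow_mul, neg_sq, mul_pow, Complex.I_sq]; push_cast; ring
  rw [hs.tsum_eq, integral_taylorTerm hα hρR hW]
  simp_rw [hmom]
  rw [integral_const_mul, hI, div_pow]
  have hG : (Real.Gamma ((m : ℝ) + (d : ℝ) / 2) : ℂ) ≠ 0 := by
    exact_mod_cast (Real.Gamma_pos_of_pos (by positivity)).ne'
  have hf' : (Nat.factorial (2 * m) : ℂ) ≠ 0 := by exact_mod_cast hf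
  have hm' : (Nat.factorial m : ℂ) ≠ 0 := by exact_mod_cast m.factorial_ne_zero
  push_cast
  field_simp

/-- The radial series sums to the spherical integral of the density. -/
lemma radial_series {d : ℕ} (hd : 2 ≤ d) {α R ρ : ℝ} (hα : 1 < α) {Λ : Measure (Sph d)}
    [IsFiniteMeasure Λ] {μ : Measure (Ed d)} [IsProbabilityMeasure μ]
    (hμ : IsStableChar d α Λ μ) (hρ : 0 ≤ ρ) (hρR : ρ < R)
    (hW : ∀ v, ‖(R : ℂ) - Vfun d α Λ v‖ ≤ ρ) {g : Ed d → ℝ} (hg : IsDensityOf d α Λ g)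
    (r : ℝ) :
    (((r / 2) ^ (d - 1) / (Real.pi ^ ((d : ℝ) / 2) * α) : ℝ) : ℂ) *
        ∑' n : ℕ, (((-(r ^ 2) / 4) ^ n / ((Nat.factorial n : ℝ) *
            Real.Gamma ((n : ℝ) + (d : ℝ) / 2)) : ℝ) : ℂ) *
          ∑' k : ℕ, (radCoef d α R (2 * n) k : ℂ) *
              ∫ u, ((R : ℂ) - Vfun d α Λ u) ^ k ∂(ωd d) =
      ((r ^ (d - 1) * ∫ u : Sph d, g (r • (u : Ed d)) ∂(ωd d) : ℝ) : ℂ) := by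
  set c : ℂ := ((((2 * Real.pi) ^ d)⁻¹ : ℝ) : ℂ) with hc
  have hsb : Summable fun n : ℕ => ‖c‖ * (|r| ^ n / (Nat.factorial n : ℝ) *
      radMomentR d α n (R - ρ) * (ωd d).real Set.univ) :=
    ((summable_radMomentR hα (sub_pos.2 hρR) (abs_nonneg r)).mul_right _).mul_left _
  have h1 := hasSum_integral_of_dominated_convergence (μ := ωd d)
    (F := fun n u => c * taylorTerm d α Λ r u n)
    (fun n _ => ‖c‖ * (|r| ^ n / (Nat.factorial n : ℝ) *
      radMomentR d α n (R - ρ) * (ωd d).real Set.univ))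
    (fun n => (continuous_const.mul (continuous_taylorTerm hα hρR hW r n)).aestronglyMeasurable)
    (fun n => .of_forall fun u => by
      rw [norm_mul]; gcongr; exact norm_taylorTerm_le hα hρR hW r u n)
    (.of_forall fun _ => hsb) (integrable_const _)
    (.of_forall fun u => hasSum_taylorTerm hd hα hμ hρR hW hg r u)
  simp_rw [integral_const_mul] at h1
  have hinj : Function.Injective fun m : ℕ => 2 * m := fun a b h => by
    simpa using h
  rw [← hinj.hasSum_iff] at h1
  · have h2 := h1.tsum_eq
    simp only [Function.comp_apply] at h2
    simp_rw [integral_taylorTerm_even hd hα hρ hρR hW, tsum_mul_left] at h2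
    rw [integral_complex_ofReal] at h2
    rw [Complex.ofReal_mul (r ^ (d - 1)), ← h2, ← mul_assoc, ← mul_assoc, hc]
    congr 1
    rw [← Complex.ofReal_mul, ← Complex.ofReal_mul]
    congr 1
    have h3 : Real.pi ^ d = Real.pi ^ ((d : ℝ) / 2) * Real.pi ^ ((d : ℝ) / 2) := by
      rw [← Real.rpow_add Real.pi_pos, add_halves, Real.rpow_natCast]
    have hpi : Real.pi ^ ((d : ℝ) / 2) ≠ 0 := (Real.rpow_pos_of_pos Real.pi_pos _).ne'
    have hα0 : α ≠ 0 := by linarith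
    have h4 : (2 : ℝ) ^ d = 2 * 2 ^ (d - 1) := (mul_pow_sub_one (by omega) 2).symm
    rw [mul_pow, h3, h4, div_pow]
    field_simp
  · intro n hn
    have hodd : Odd n := by
      rw [← Nat.not_even_iff_odd]
      rintro ⟨m, rfl⟩
      exact hn ⟨m, two_mul m⟩
    rw [integral_taylorTerm_odd hd hα hρR hW r hodd, mul_zero]

/-- The law of the norm under a measure with density `g`. -/
lemma map_norm_apply {d : ℕ} (hd : 2 ≤ d) {μ : Measure (Ed d)} {g : Ed d → ℝ}
    (hμg : μ = volume.withDensity (fun x => ENNReal.ofReal (g x))) (hg0 : ∀ᵐ x, 0 ≤ g x)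
    (hgi : Integrable g) {s : Set ℝ} (hs : MeasurableSet s) :
    μ.map (fun x => ‖x‖) s = ENNReal.ofReal (∫ r in s ∩ Set.Ioi 0,
      r ^ (d - 1) * ∫ u : Sph d, g (r • (u : Ed d)) ∂(ωd d)) := by
  have hS : MeasurableSet ((fun x : Ed d => ‖x‖) ⁻¹' s) := measurable_norm hs
  rw [Measure.map_apply measurable_norm hs, hμg, withDensity_apply _ hS,
    ← ofReal_integral_eq_lintegral_ofReal hgi.integrableOn (ae_restrict_of_ae hg0)]
  congr 1
  rw [← integral_indicator hS, integral_polar' hd (hgi.indicator hS), integral_radMeas,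
    Set.inter_comm, ← setIntegral_indicator hs]
  refine setIntegral_congr_fun measurableSet_Ioi fun r hr => ?_
  have hn : ∀ u : Sph d, ‖r • (u : Ed d)‖ = r := fun u => by
    rw [norm_smul, norm_sph, mul_one, Real.norm_of_nonneg (le_of_lt hr)]
  by_cases hrs : r ∈ s
  · simp [Set.indicator, hn, hrs]
  · simp [Set.indicator, hn, hrs]

/-- Theorem (density, `α ∈ (1,2)`, expansion around `R`): series representation of `g`
in terms of `S*_{j,k}`, uniformly absolutely convergent on `{|x| ≤ M}`, and the
corresponding series for the density of `|X|`. -/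
theorem stmt17 (d : ℕ) (hd : 2 ≤ d) (α : ℝ) (hα1 : 1 < α) (hα2 : α < 2)
    (Λ : Measure (Sph d)) [IsFiniteMeasure Λ] (hΛ : Λ ≠ 0)
    (μ : Measure (Ed d)) [IsProbabilityMeasure μ] (hμ : IsStableChar d α Λ μ)
    (hnd : Nondegenerate d μ)
    (R : ℝ) (hR : (⨆ u : Sph d, ‖Vfun d α Λ u‖ ^ 2 / (2 * (Vfun d α Λ u).re)) < R)
    (g : Ed d → ℝ) (hg : IsDensityOf d α Λ g) :
    (∀ (x : Ed d) (u : Sph d), x = ‖x‖ • (u : Ed d) →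
      (g x : ℂ) = (((2 : ℝ) ^ (1 - (d : ℝ)) / (Real.pi ^ ((d : ℝ) / 2) * α) : ℝ) : ℂ) *
        ∑' n : ℕ, (((‖x‖ / 2) ^ n : ℝ) : ℂ) *
          ∑ m ∈ Finset.range (n / 2 + 1),
            (((-1 : ℝ) ^ m / ((Nat.factorial m : ℝ) *
                Real.Gamma ((n : ℝ) - m + (d : ℝ) / 2)) : ℝ) : ℂ) *
              ∑' k : ℕ,
                ((Real.Gamma ((k : ℝ) + ((n : ℝ) + d) / α) /
                    ((Nat.factorial k : ℝ) * R ^ ((k : ℝ) + ((n : ℝ) + d) / α)) : ℝ) : ℂ) *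
                  SHstar d α Λ R (n - 2 * m) k u) ∧
    (∀ M : ℝ, 0 < M → ∃ c : ℕ → ℝ, Summable c ∧
      ∀ (n : ℕ) (x : Ed d) (u : Sph d), x = ‖x‖ • (u : Ed d) → ‖x‖ ≤ M →
        ∑ m ∈ Finset.range (n / 2 + 1),
          ∑' k : ℕ,
            ‖(((‖x‖ / 2) ^ n : ℝ) : ℂ) *
              ((((-1 : ℝ) ^ m / ((Nat.factorial m : ℝ) *
                  Real.Gamma ((n : ℝ) - m + (d : ℝ) / 2)) : ℝ) : ℂ) *
                (((Real.Gamma ((k : ℝ) + ((n : ℝ) + d) / α) /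
                    ((Nat.factorial k : ℝ) * R ^ ((k : ℝ) + ((n : ℝ) + d) / α)) : ℝ) : ℂ) *
                  SHstar d α Λ R (n - 2 * m) k u))‖ ≤ c n) ∧
    (∀ r : ℝ, 0 < r →
      ((((r / 2) ^ (d - 1) / (Real.pi ^ ((d : ℝ) / 2) * α) : ℝ) : ℂ) *
        ∑' n : ℕ, (((-(r ^ 2) / 4) ^ n / ((Nat.factorial n : ℝ) *
            Real.Gamma ((n : ℝ) + (d : ℝ) / 2)) : ℝ) : ℂ) *
          ∑' k : ℕ,
            ((Real.Gamma ((k : ℝ) + (2 * (n : ℝ) + d) / α) /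
                ((Nat.factorial k : ℝ) * R ^ ((k : ℝ) + (2 * (n : ℝ) + d) / α)) : ℝ) : ℂ) *
              ∫ u, ((R : ℂ) - Vfun d α Λ u) ^ k ∂(ωd d)).im = 0) ∧
    ∀ s : Set ℝ, MeasurableSet s →
      μ.map (fun x : Ed d => ‖x‖) s =
        ENNReal.ofReal (∫ r in s ∩ Set.Ioi 0,
          ((((r / 2) ^ (d - 1) / (Real.pi ^ ((d : ℝ) / 2) * α) : ℝ) : ℂ) *
            ∑' n : ℕ, (((-(r ^ 2) / 4) ^ n / ((Nat.factorial n : ℝ) *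
                Real.Gamma ((n : ℝ) + (d : ℝ) / 2)) : ℝ) : ℂ) *
              ∑' k : ℕ,
                ((Real.Gamma ((k : ℝ) + (2 * (n : ℝ) + d) / α) /
                    ((Nat.factorial k : ℝ) * R ^ ((k : ℝ) + (2 * (n : ℝ) + d) / α)) : ℝ) : ℂ) *
                  ∫ u, ((R : ℂ) - Vfun d α Λ u) ^ k ∂(ωd d)).re) := by
  obtain ⟨ρ, hρ, hρR, hW⟩ := exists_rho hd hα1 Λ (Vfun_re_pos hα1 Λ μ hμ hnd) R hR
  have hφ := integrable_exp_neg_charExp hd hα1 hμ hρR hW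
  have hrad : ∀ r : ℝ, ((((r / 2) ^ (d - 1) / (Real.pi ^ ((d : ℝ) / 2) * α) : ℝ) : ℂ) *
      ∑' n : ℕ, (((-(r ^ 2) / 4) ^ n / ((Nat.factorial n : ℝ) *
          Real.Gamma ((n : ℝ) + (d : ℝ) / 2)) : ℝ) : ℂ) *
        ∑' k : ℕ,
          ((Real.Gamma ((k : ℝ) + (2 * (n : ℝ) + d) / α) /
              ((Nat.factorial k : ℝ) * R ^ ((k : ℝ) + (2 * (n : ℝ) + d) / α)) : ℝ) : ℂ) *
            ∫ u, ((R : ℂ) - Vfun d α Λ u) ^ k ∂(ωd d)) =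
      ((r ^ (d - 1) * ∫ u : Sph d, g (r • (u : Ed d)) ∂(ωd d) : ℝ) : ℂ) := fun r => by
    rw [← radial_series hd hα1 hμ hρ hρR hW hg r]
    simp only [radCoef, Nat.cast_mul, Nat.cast_ofNat]
  refine ⟨fun x u hx => ?_, fun M hM => ?_, fun r _ => ?_, fun s hs => ?_⟩
  · conv_lhs => rw [hx]
    exact density_series hd hα1 hμ hρ hρR hW hg ‖x‖ u
  · obtain ⟨c, hc, hcb⟩ := series_bound hd hα1 hρ hρR hW hM
    exact ⟨c, hc, fun n x u _ hxM => hcb n ‖x‖ u (norm_nonneg x) hxM⟩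
  · rw [hrad, Complex.ofReal_im]
  · obtain ⟨hμg, hg0⟩ := eq_withDensity_density hμ hφ hg
    simp_rw [hrad, Complex.ofReal_re]
    exact map_norm_apply hd hμg hg0 (integrable_density hμ hφ hg) hs

end StablePaper
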